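/- Let G be a digraph and B ⊆ V(G) such that there are neither infinitely many pairwise vertex-disjoint rays dominating B nor infinitely many vertices dominating B. Then 𝓛(G,B), the collection of all vertex sets linkable to B by pairwise vertex-disjoint directed paths, is the set of independent sets of a (nearly finitary) matroid. -/

import Mathlib

/-- A (finite) directed path in the digraph with adjacency `Adj`:
a nonempty list of distinct vertices whose consecutive pairs are edges. -/
structure DiPath {V : Type*} (Adj : V → V → Prop) : Type _ where
  verts : List V
  ne : verts ≠ []
  chain : verts.Chain' Adj
  nodup : verts.Nodup

namespace DiPath
variable {V : Type*} {Adj : V → V → Prop}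
/-- The first vertex of a directed path. -/
def first (P : DiPath Adj) : V := P.verts.head P.ne
/-- The last vertex of a directed path. -/
def last (P : DiPath Adj) : V := P.verts.getLast P.ne
/-- The (directed) edges of a path, as ordered pairs of consecutive vertices. -/
def edges (P : DiPath Adj) : List (V × V) := P.verts.zip P.verts.tail
/-- The edge set of a path. -/
def edgeSet (P : DiPath Adj) : Set (V × V) := {e | e ∈ P.edges}
/-- The vertex set of a path. -/
def vertexSet (P : DiPath Adj) : Set V := {v | v ∈ P.verts}
end DiPath

/-- A directed ray: a one-way infinite directed path. -/
structure DiRay {V : Type*} (Adj : V → V → Prop) : Type _ where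
  f : ℕ → V
  inj : Function.Injective f
  adj : ∀ n, Adj (f n) (f (n + 1))

namespace DiRay
variable {V : Type*} {Adj : V → V → Prop}
/-- The first vertex of a ray. -/
def first (R : DiRay Adj) : V := R.f 0
/-- The edge set of a ray. -/
def edgeSet (R : DiRay Adj) : Set (V × V) := Set.range fun n => (R.f n, R.f (n + 1))
/-- The vertex set of a ray. -/
def vertexSet (R : DiRay Adj) : Set V := Set.range R.f
end DiRay

/-- A path or a ray. -/
inductive PR {V : Type*} (Adj : V → V → Prop) : Type _
  | path : DiPath Adj → PR Adj
  | ray : DiRay Adj → PR Adj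

namespace PR
variable {V : Type*} {Adj : V → V → Prop}
/-- The first vertex. -/
def first : PR Adj → V
  | .path P => P.first
  | .ray R => R.first
/-- The edge set. -/
def edgeSet : PR Adj → Set (V × V)
  | .path P => P.edgeSet
  | .ray R => R.edgeSet
/-- The vertex set. -/
def vertexSet : PR Adj → Set V
  | .path P => P.vertexSet
  | .ray R => R.vertexSet
end PR

/-- A vertex `v` dominates the set `B` (vertex version): there are infinitely many
directed `v`–`B` paths, pairwise vertex-disjoint except in `v`. -/
def VDomSet {V : Type*} (Adj : V → V → Prop) (B : Set V) (v : V) : Prop :=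
  ∃ P : ℕ → DiPath Adj, Function.Injective P ∧ (∀ n, (P n).first = v) ∧
    (∀ n, (P n).last ∈ B) ∧
    ∀ m n, m ≠ n → ∀ x ∈ (P m).vertexSet, x ∈ (P n).vertexSet → x = v

/-- A ray `R` dominates the set `B`: there are infinitely many pairwise
vertex-disjoint directed paths from `R` to `B`. -/
def RDomSet {V : Type*} (Adj : V → V → Prop) (B : Set V) (R : DiRay Adj) : Prop :=
  ∃ P : ℕ → DiPath Adj, Function.Injective P ∧ (∀ n, (P n).first ∈ R.vertexSet) ∧
    (∀ n, (P n).last ∈ B) ∧ ∀ m n, m ≠ n → Disjoint (P m).vertexSet (P n).vertexSet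

/-- A path or ray is good for `B` (vertex version): it ends in `B` or dominates `B`
(a path dominates `B` if its last vertex does). -/
def PR.GoodV {V : Type*} {Adj : V → V → Prop} (B : Set V) : PR Adj → Prop
  | .path P => P.last ∈ B ∨ VDomSet Adj B P.last
  | .ray R => RDomSet Adj B R

/-- A domination linkage (vertex version) from `A` to `B`: pairwise vertex-disjoint
directed paths or rays, one starting at each vertex of `A`, each ending in `B`
or dominating `B`. -/
def VDomLinkage {V : Type*} (Adj : V → V → Prop) (A B : Set V) : Prop :=
  ∃ Q : A → PR Adj, (∀ a : A, (Q a).first = (a : V)) ∧ (∀ a, (Q a).GoodV B) ∧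
    ∀ a a' : A, a ≠ a' → Disjoint (Q a).vertexSet (Q a').vertexSet

/-- The finite set `S` can be linked to `B` by pairwise vertex-disjoint directed
paths, one starting at each vertex of `S`, each ending in `B`. -/
def VFinLinked {V : Type*} (Adj : V → V → Prop) (B : Set V) (S : Finset V) : Prop :=
  ∃ P : S → DiPath Adj, (∀ s, (P s).first = (s : V)) ∧ (∀ s, (P s).last ∈ B) ∧
    ∀ s t, s ≠ t → Disjoint (P s).vertexSet (P t).vertexSet

/-- `𝓛(G, B)`: the collection of vertex sets that can be linked to `B` by
pairwise vertex-disjoint directed paths. -/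
def LGB {V : Type*} (Adj : V → V → Prop) (B : Set V) : Set (Set V) :=
  {I | ∃ P : I → DiPath Adj, (∀ v : I, (P v).first = (v : V)) ∧
    (∀ v, (P v).last ∈ B) ∧
    ∀ v w : I, v ≠ w → Disjoint (P v).vertexSet (P w).vertexSet}

namespace DiLink
open Relation

section
variable {V : Type*} {Adj : V → V → Prop} {B : Set V}

theorem exists_of_reach {r : V → V → Prop} (hr : ∀ x y, r x y → x ≠ y → Adj x y) {x y : V}
    (h : ReflTransGen r x y) : ∃ P : DiPath Adj, P.first = x ∧ P.last = y ∧
      ∀ v ∈ P.verts, ReflTransGen r x v ∧ ReflTransGen r v y := by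
  suffices H : ∃ t : List V, (x :: t).IsChain Adj ∧ (x :: t).Nodup ∧
      (x :: t).getLast (by simp) = y ∧
      ∀ v ∈ x :: t, ReflTransGen r x v ∧ ReflTransGen r v y by
    obtain ⟨t, h1, h2, h3, h4⟩ := H
    exact ⟨⟨x :: t, by simp, h1, h2⟩, rfl, h3, h4⟩
  induction h using ReflTransGen.head_induction_on with
  | refl => exact ⟨[], by simp, by simp, by simp, by simpa using ReflTransGen.refl⟩
  | @head a c hac hcy ih =>
    obtain ⟨t, h1, h2, h3, h4⟩ := ih
    by_cases hmem : a ∈ c :: t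
    · obtain ⟨l1, l2, hl⟩ := List.append_of_mem hmem
      have hsuf : (a :: l2) <:+ (c :: t) := ⟨l1, hl.symm⟩
      have key : ∀ v ∈ a :: l2, ReflTransGen r a v ∧ ReflTransGen r v y := fun v hv =>
        ⟨ReflTransGen.head hac (h4 v (hsuf.subset hv)).1, (h4 v (hsuf.subset hv)).2⟩
      refine ⟨l2, h1.suffix hsuf, h2.sublist hsuf.sublist, ?_, key⟩
      rw [← h3]
      simp only [hl]
      simp
    · refine ⟨c :: t, ?_, ?_, ?_, ?_⟩
      · rw [List.isChain_cons_cons]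
        refine ⟨hr _ _ hac ?_, h1⟩
        rintro rfl
        simp at hmem
      · exact List.nodup_cons.2 ⟨hmem, h2⟩
      · rw [List.getLast_cons (by simp)]; exact h3
      · intro v hv
        rcases List.mem_cons.1 hv with rfl | hv
        · exact ⟨.refl, ReflTransGen.head hac hcy⟩
        · exact ⟨ReflTransGen.head hac (h4 v hv).1, (h4 v hv).2⟩

theorem reach_of_isChain {r : V → V → Prop} : ∀ {l : List V} (hne : l ≠ []), l.IsChain r →
    ∀ v ∈ l, ReflTransGen r (l.head hne) v ∧ ReflTransGen r v (l.getLast hne)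
  | [], hne, _, _, _ => absurd rfl hne
  | [a], _, _, v, hv => by
    obtain rfl : v = a := by simpa using hv
    exact ⟨.refl, .refl⟩
  | a :: b :: t, _, hc, v, hv => by
    rw [List.isChain_cons_cons] at hc
    have ih := reach_of_isChain (l := b :: t) (by simp) hc.2
    rw [List.getLast_cons (by simp)]
    rcases List.mem_cons.1 hv with rfl | hv
    · exact ⟨.refl, .head hc.1 (ih b (by simp)).2⟩
    · exact ⟨.head hc.1 (ih v hv).1, (ih v hv).2⟩

theorem reach_of_path (P : DiPath Adj) {v : V} (hv : v ∈ P.verts) :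
    ReflTransGen (fun a b => Adj a b ∧ a ∈ P.verts ∧ b ∈ P.verts) P.first v ∧
    ReflTransGen (fun a b => Adj a b ∧ a ∈ P.verts ∧ b ∈ P.verts) v P.last := by
  refine reach_of_isChain P.ne ?_ v hv
  have := P.chain
  exact List.IsChain.imp_of_mem_imp (fun a b ha hb h => ⟨h, ha, hb⟩) this

theorem first_mem (P : DiPath Adj) : P.first ∈ P.verts := List.head_mem _
theorem last_mem (P : DiPath Adj) : P.last ∈ P.verts := List.getLast_mem _

/-- `f` describes a family of pairwise disjoint paths, trivial outside these paths:
`f v` is the successor of `v`, and `none` at the end of a path; each element of `I` is the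
first vertex of a path. -/
structure IsLinking (Adj : V → V → Prop) (B I : Set V) (f : V → Option V) : Prop where
  adj : ∀ v w, f v = some w → w = v ∨ Adj v w
  term : ∀ v, f v = none → v ∈ B
  inj : ∀ u v w, f u = some w → f v = some w → u = v
  src : ∀ v w, f v = some w → w ∉ I
  fin : ¬ ∃ s : ℕ → V, Function.Injective s ∧ ∀ n, f (s n) = some (s (n + 1))

theorem IsLinking.mono {I J : Set V} {f : V → Option V} (h : IsLinking Adj B I f) (hJ : J ⊆ I) :
    IsLinking Adj B J f := { h with src := fun v w hv hw => h.src v w hv (hJ hw) }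

open Classical in
noncomputable def nextIn (l : List V) (v : V) : Option V := l[l.idxOf v + 1]?

theorem nextIn_some {l : List V} {v w : V} (hv : v ∈ l) (h : nextIn l v = some w)
    (hc : l.IsChain Adj) : Adj v w ∧ w ∈ l := by
  classical
  unfold nextIn at h
  obtain ⟨h1, h2⟩ := List.getElem?_eq_some_iff.1 h
  refine ⟨?_, h2 ▸ List.getElem_mem _⟩
  have := List.isChain_iff_getElem.1 hc (l.idxOf v) (by convert h1)
  have e : l[l.idxOf v]'(List.idxOf_lt_length_iff.2 hv) = v := List.getElem_idxOf _
  rw [e] at this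
  rw [← h2]; convert this

theorem nextIn_inj {l : List V} {u v w : V} (hn : l.Nodup) (hu : u ∈ l)
    (h : nextIn l u = some w) (h' : nextIn l v = some w) : u = v := by
  classical
  unfold nextIn at h h'
  obtain ⟨h1, h2⟩ := List.getElem?_eq_some_iff.1 h
  obtain ⟨h3, h4⟩ := List.getElem?_eq_some_iff.1 h'
  have := (hn.getElem_inj_iff).1 (h2.trans h4.symm)
  have e : l.idxOf u = l.idxOf v := by convert Nat.succ_injective this
  exact (List.idxOf_inj hu).1 e

theorem nextIn_ne_head {l : List V} {v : V} (hne : l ≠ []) (hn : l.Nodup) :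
    nextIn l v ≠ some (l.head hne) := by
  classical
  intro h
  unfold nextIn at h
  obtain ⟨h1, h2⟩ := List.getElem?_eq_some_iff.1 h
  rw [List.head_eq_getElem] at h2
  have := (hn.getElem_inj_iff).1 h2
  omega

theorem nextIn_none {l : List V} {v : V} (hne : l ≠ []) (hv : v ∈ l) (h : nextIn l v = none) :
    v = l.getLast hne := by
  classical
  unfold nextIn at h
  have h1 := List.getElem?_eq_none_iff.1 h
  have h2 := List.idxOf_lt_length_iff.2 hv
  rw [List.getLast_eq_getElem]
  have e : l[l.idxOf v]'h2 = v := List.getElem_idxOf _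
  rw [← e]
  congr 1
  have h2' : l.idxOf v < l.length := by convert h2
  have : l.idxOf v = l.length - 1 := by
    have h1' : l.length ≤ l.idxOf v + 1 := by convert h1
    omega
  convert this

theorem exists_isLinking_of_mem {I : Set V} (h : I ∈ LGB Adj B) : ∃ f, IsLinking Adj B I f := by
  classical
  obtain ⟨P, h1, h2, h3⟩ := h
  have huniq : ∀ (i j : I) v, v ∈ (P i).verts → v ∈ (P j).verts → i = j := by
    intro i j v hi hj
    by_contra hne
    exact Set.disjoint_left.1 (h3 i j hne) hi hj
  let f : V → Option V := fun v => if h : ∃ i, v ∈ (P i).verts then nextIn (P h.choose).verts v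
    else some v
  have f1 : ∀ i v, v ∈ (P i).verts → f v = nextIn (P i).verts v := by
    intro i v hv
    have h : ∃ i, v ∈ (P i).verts := ⟨i, hv⟩
    simp only [f, dif_pos h]
    rw [huniq _ _ _ h.choose_spec hv]
  have f2 : ∀ v, (¬ ∃ i, v ∈ (P i).verts) → f v = some v := fun v h => by simp only [f, dif_neg h]
  have f3 : ∀ i v w, v ∈ (P i).verts → f v = some w → w ∈ (P i).verts := by
    intro i v w hv hw
    rw [f1 i v hv] at hw
    exact (nextIn_some hv hw (P i).chain).2
  refine ⟨f, ?_, ?_, ?_, ?_, ?_⟩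
  · intro v w hw
    by_cases h : ∃ i, v ∈ (P i).verts
    · obtain ⟨i, hi⟩ := h
      rw [f1 i v hi] at hw
      exact Or.inr (nextIn_some hi hw (P i).chain).1
    · rw [f2 v h] at hw
      exact Or.inl (by simpa using hw.symm)
  · intro v hv
    by_cases h : ∃ i, v ∈ (P i).verts
    · obtain ⟨i, hi⟩ := h
      rw [f1 i v hi] at hv
      rw [nextIn_none (P i).ne hi hv]
      exact h2 i
    · rw [f2 v h] at hv
      simp at hv
  · intro u v w hu hv
    by_cases h : ∃ i, u ∈ (P i).verts
    · obtain ⟨i, hi⟩ := h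
      have hw := f3 i u w hi hu
      by_cases h' : ∃ i, v ∈ (P i).verts
      · obtain ⟨j, hj⟩ := h'
        obtain rfl := huniq _ _ _ hw (f3 j v w hj hv)
        rw [f1 _ _ hi] at hu
        rw [f1 _ _ hj] at hv
        exact nextIn_inj (P i).nodup hi hu hv
      · rw [f2 v h'] at hv
        obtain rfl : v = w := by simpa using hv
        exact absurd ⟨i, hw⟩ h'
    · rw [f2 u h] at hu
      obtain rfl : u = w := by simpa using hu
      by_cases h' : ∃ i, v ∈ (P i).verts
      · obtain ⟨j, hj⟩ := h'
        exact absurd ⟨j, f3 j v u hj hv⟩ h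
      · rw [f2 v h'] at hv
        simpa using hv.symm
  · intro v w hv hw
    have hw' : w ∈ (P ⟨w, hw⟩).verts := by
      have := first_mem (P ⟨w, hw⟩)
      rwa [h1] at this
    have : v ∈ (P ⟨w, hw⟩).verts := by
      by_cases h : ∃ i, v ∈ (P i).verts
      · obtain ⟨i, hi⟩ := h
        have hw2 := f3 i v w hi hv
        rwa [huniq _ _ _ hw' hw2]
      · rw [f2 v h] at hv
        obtain rfl : v = w := by simpa using hv
        exact hw'
    rw [f1 _ _ this] at hv
    have e := h1 ⟨w, hw⟩
    refine nextIn_ne_head (P ⟨w, hw⟩).ne (P ⟨w, hw⟩).nodup (v := v) ?_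
    rw [hv]
    exact congrArg some e.symm
  · rintro ⟨s, hs, hf⟩
    by_cases h : ∃ i, s 0 ∈ (P i).verts
    · obtain ⟨i, hi⟩ := h
      have hall : ∀ n, s n ∈ (P i).verts := by
        intro n
        induction n with
        | zero => exact hi
        | succ n ih => exact f3 i _ _ ih (hf n)
      exact Set.infinite_of_injective_forall_mem hs (s := {v | v ∈ (P i).verts}) hall
        (List.finite_toSet _)
    · have := hf 0
      rw [f2 _ h] at this
      have := hs (Option.some.inj this)
      omega

theorem mem_LGB_of_rel {I : Set V} (Q : V → V → Prop)
    (h : ∀ i ∈ I, ∃ P : DiPath Adj, P.first = i ∧ P.last ∈ B ∧ ∀ v ∈ P.verts, Q i v)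
    (hQ : ∀ i ∈ I, ∀ j ∈ I, ∀ v, Q i v → Q j v → i = j) : I ∈ LGB Adj B := by
  choose P h1 h2 h3 using h
  refine ⟨fun i => P i i.2, fun i => h1 i i.2, fun i => h2 i i.2, fun i j hij => ?_⟩
  refine Set.disjoint_left.2 fun v hv hv' => hij (Subtype.ext ?_)
  exact hQ i i.2 j j.2 v (h3 i i.2 v hv) (h3 j j.2 v hv')

/-- `y` is the successor of `x`. -/
def FStep (f : V → Option V) (x y : V) : Prop := f x = some y

theorem exists_ray_of_not_ends {f : V → Option V} {i : V}
    (hinj : ∀ u v w, f u = some w → f v = some w → u = v) (hi : ∀ u, f u ≠ some i)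
    (h : ∀ t, ReflTransGen (FStep f) i t → f t ≠ none) :
    ∃ s : ℕ → V, Function.Injective s ∧ s 0 = i ∧ ∀ n, f (s n) = some (s (n + 1)) := by
  let nx : V → V := fun v => (f v).getD v
  let s : ℕ → V := fun n => nx^[n] i
  have hs : ∀ n, s (n + 1) = nx (s n) := fun n => Function.iterate_succ_apply' _ _ _
  have hnx : ∀ v, f v ≠ none → f v = some (nx v) := by
    intro v hv
    obtain ⟨w, hw⟩ := Option.ne_none_iff_exists'.1 hv
    simp [nx, hw]
  have hr : ∀ n, ReflTransGen (FStep f) i (s n) := by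
    intro n
    induction n with
    | zero => exact .refl
    | succ n ih =>
      refine ih.tail ?_
      rw [hs]
      exact hnx _ (h _ ih)
  have hstep : ∀ n, f (s n) = some (s (n + 1)) := fun n => by
    rw [hs]; exact hnx _ (h _ (hr n))
  have key : ∀ m k, s m = s (m + k + 1) → False := by
    intro m
    induction m with
    | zero => 
      intro k hk
      refine hi (s (0 + k)) ?_
      rw [hstep, ← hk]; rfl
    | succ m ih =>
      intro k hk
      refine ih k (hinj _ _ _ (hstep m) ?_)
      rw [hstep, hk]
      congr 2; omega
  refine ⟨s, ?_, rfl, hstep⟩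
  intro m n hmn
  rcases lt_trichotomy m n with h | h | h
  · obtain ⟨k, rfl⟩ := Nat.exists_eq_add_of_lt h
    exact (key _ _ hmn).elim
  · exact h
  · obtain ⟨k, rfl⟩ := Nat.exists_eq_add_of_lt h
    exact (key _ _ hmn.symm).elim

theorem eq_of_reach_of_reach {f : V → Option V} {i j v : V}
    (hinj : ∀ u v w, f u = some w → f v = some w → u = v) (hi : ∀ u, f u ≠ some i)
    (hj : ∀ u, f u ≠ some j) (h : ReflTransGen (FStep f) i v) (h' : ReflTransGen (FStep f) j v) :
    i = j := by
  induction h with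
  | refl =>
    rcases h'.cases_tail with h | ⟨u, -, hu⟩
    · exact h
    · exact absurd hu (hi u)
  | @tail u v _ huv ih =>
    rcases h'.cases_tail with rfl | ⟨u', h1, hu⟩
    · exact absurd huv (hj u)
    · obtain rfl := hinj _ _ _ huv hu
      exact ih h1

theorem IsLinking.ends {I : Set V} {f : V → Option V} (h : IsLinking Adj B I f) {i : V}
    (hi : ∀ u, f u ≠ some i) : ∃ t, ReflTransGen (FStep f) i t ∧ f t = none := by
  by_contra! hc
  obtain ⟨s, h1, -, h2⟩ := exists_ray_of_not_ends h.inj hi hc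
  exact h.fin ⟨s, h1, h2⟩

theorem IsLinking.exists_path {I : Set V} {f : V → Option V} (h : IsLinking Adj B I f) {i : V}
    (hi : ∀ u, f u ≠ some i) : ∃ P : DiPath Adj, P.first = i ∧ P.last ∈ B ∧
      (∀ v ∈ P.verts, ReflTransGen (FStep f) i v) ∧ f P.last = none := by
  obtain ⟨t, h1, h2⟩ := h.ends hi
  obtain ⟨P, h3, h4, h5⟩ := exists_of_reach (Adj := Adj) (r := FStep f)
    (fun x y hxy hne => (h.adj x y hxy).resolve_left (Ne.symm hne)) h1
  exact ⟨P, h3, h4 ▸ h.term t h2, fun v hv => (h5 v hv).1, h4 ▸ h2⟩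

theorem IsLinking.mem {I : Set V} {f : V → Option V} (h : IsLinking Adj B I f) :
    I ∈ LGB Adj B := by
  refine mem_LGB_of_rel (ReflTransGen (FStep f)) (fun i hi => ?_) (fun i hi j hj v h1 h2 =>
    eq_of_reach_of_reach h.inj (fun u hu => h.src _ _ hu hi) (fun u hu => h.src _ _ hu hj) h1 h2)
  obtain ⟨P, h1, h2, h3, -⟩ := h.exists_path (i := i) (fun u hu => h.src _ _ hu hi)
  exact ⟨P, h1, h2, h3⟩

theorem mem_LGB_iff {I : Set V} : I ∈ LGB Adj B ↔ ∃ f, IsLinking Adj B I f :=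
  ⟨exists_isLinking_of_mem, fun ⟨_, h⟩ => h.mem⟩

theorem LGB_mono {I J : Set V} (h : I ∈ LGB Adj B) (hJ : J ⊆ I) : J ∈ LGB Adj B := by
  obtain ⟨f, hf⟩ := mem_LGB_iff.1 h
  exact (hf.mono hJ).mem

theorem fin_of_finite_ne {f g : V → Option V}
    (hf : ¬ ∃ s : ℕ → V, Function.Injective s ∧ ∀ n, f (s n) = some (s (n + 1)))
    (hfg : {v | f v ≠ g v}.Finite) :
    ¬ ∃ s : ℕ → V, Function.Injective s ∧ ∀ n, g (s n) = some (s (n + 1)) := by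
  rintro ⟨s, hs, hg⟩
  have hfin : (s ⁻¹' {v | f v ≠ g v}).Finite := hfg.preimage hs.injOn
  obtain ⟨N, hN⟩ := hfin.bddAbove
  refine hf ⟨fun n => s (N + 1 + n), fun a b h => by simpa using hs h, fun n => ?_⟩
  have : f (s (N + 1 + n)) = g (s (N + 1 + n)) := by
    by_contra hne
    have := hN (show N + 1 + n ∈ s ⁻¹' {v | f v ≠ g v} from hne)
    omega
  rw [this, hg]; rfl

open Classical in
theorem fin_update {f : V → Option V}
    (hf : ¬ ∃ s : ℕ → V, Function.Injective s ∧ ∀ n, f (s n) = some (s (n + 1))) (u : V)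
    (c : Option V) : ¬ ∃ s : ℕ → V, Function.Injective s ∧
      ∀ n, Function.update f u c (s n) = some (s (n + 1)) := by
  refine fin_of_finite_ne hf ((Set.finite_singleton u).subset fun v hv => ?_)
  by_contra hne
  exact hv (Function.update_of_ne hne _ _).symm

/-- A step of an alternating walk: back along the linking `f` and then forward along an edge. -/
def AltStep (Adj : V → V → Prop) (f : V → Option V) (y w : V) : Prop :=
  ∃ u, f u = some y ∧ (w = u ∨ Adj u w)

open Classical in
theorem IsLinking.augment_aux {I : Set V} {f : V → Option V} (hf : IsLinking Adj B I f) {y : V}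
    (hy : (∀ u, f u ≠ some y) ∨ ∃ u ∈ B, f u = some y) : ∀ (l : List V) (x : V),
    (x :: l).IsChain (AltStep Adj f) → (x :: l).Nodup → (x :: l).getLast (by simp) = y →
    ∃ g : V → Option V, IsLinking Adj B (insert x (I \ {y})) g ∧
      (∀ u, (∀ z ∈ x :: l, f u ≠ some z) → g u = f u) ∧
      (∀ v w, g v = some w → w = y ∨ ∃ u, f u = some w)
  | [], x, _, _, hl => by
    obtain rfl : x = y := by simpa using hl
    rcases hy with hy | ⟨u, huB, hu⟩
    · refine ⟨f, { hf with src := ?_ }, fun _ _ => rfl, fun v w h => Or.inr ⟨v, h⟩⟩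
      rintro v w hv (rfl | hw)
      · exact hy v hv
      · exact hf.src v w hv hw.1
    · have key : ∀ v w, Function.update f u none v = some w → f v = some w ∧ v ≠ u := by
        intro v w h
        by_cases hvu : v = u
        · subst hvu; simp at h
        · rw [Function.update_of_ne hvu] at h; exact ⟨h, hvu⟩
      refine ⟨Function.update f u none, ⟨fun v w h => hf.adj v w (key v w h).1, ?_,
        fun a b w h h' => hf.inj a b w (key _ _ h).1 (key _ _ h').1, ?_, fin_update hf.fin _ _⟩,
        ?_, fun v w h => Or.inr ⟨v, (key v w h).1⟩⟩
      · intro v hv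
        by_cases hvu : v = u
        · subst hvu; exact huB
        · rw [Function.update_of_ne hvu] at hv; exact hf.term v hv
      · rintro v w hv (rfl | hw)
        · exact (key _ _ hv).2 (hf.inj _ _ _ (key _ _ hv).1 hu)
        · exact hf.src v w (key _ _ hv).1 hw.1
      · intro v hv
        refine Function.update_of_ne ?_ _ _
        rintro rfl
        exact hv x (by simp) hu
  | x' :: l, x, hc, hn, hl => by
    rw [List.isChain_cons_cons] at hc
    obtain ⟨⟨u, hu, hux⟩, hc⟩ := hc
    obtain ⟨hx, hn⟩ := List.nodup_cons.1 hn
    rw [List.getLast_cons (by simp)] at hl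
    obtain ⟨g, hg, hg1, hg2⟩ := hf.augment_aux hy l x' hc hn hl
    have hgu : g u = some x := by
      rw [hg1 u, hu]
      intro z hz h
      rw [hu] at h
      obtain rfl := Option.some.inj h
      exact hx hz
    have key : ∀ v w, Function.update g u (some x') v = some w →
        (v = u ∧ w = x') ∨ (v ≠ u ∧ g v = some w) := by
      intro v w h
      by_cases hvu : v = u
      · subst hvu; left; simpa using h.symm
      · rw [Function.update_of_ne hvu] at h; exact Or.inr ⟨hvu, h⟩
    have hx' : ∀ v, g v ≠ some x' := fun v h => hg.src v x' h (Or.inl rfl)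
    refine ⟨Function.update g u (some x'), ⟨?_, ?_, ?_, ?_, fin_update hg.fin _ _⟩, ?_, ?_⟩
    · intro v w h
      rcases key v w h with ⟨rfl, rfl⟩ | ⟨-, h⟩
      · exact hux
      · exact hg.adj v w h
    · intro v hv
      by_cases hvu : v = u
      · subst hvu; simp at hv
      · rw [Function.update_of_ne hvu] at hv; exact hg.term v hv
    · intro a b w ha hb
      rcases key a w ha with ⟨rfl, rfl⟩ | ⟨-, h⟩ <;> rcases key b w hb with ⟨rfl, h'⟩ | ⟨-, h'⟩
      · rfl
      · exact absurd h' (hx' b)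
      · exact absurd (h' ▸ h) (hx' a)
      · exact hg.inj _ _ _ h h'
    · rintro v w hv hw
      rcases key v w hv with ⟨rfl, rfl⟩ | ⟨hvu, h⟩
      · rcases hw with rfl | hw
        · simp at hx
        · cases l with
          | nil => exact hw.2 (by simpa using hl)
          | cons z l =>
            rw [List.isChain_cons_cons] at hc
            obtain ⟨⟨u', hu', -⟩, -⟩ := hc
            exact hf.src _ _ hu' hw.1
      · rcases hw with rfl | hw
        · exact hvu (hg.inj _ _ _ h hgu)
        · exact hg.src _ _ h (Or.inr hw)
    · intro v hv
      rw [Function.update_of_ne, hg1 v fun z hz => hv z (List.mem_cons_of_mem _ hz)]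
      rintro rfl
      exact hv x (by simp) hu
    · intro v w h
      rcases key v w h with ⟨rfl, rfl⟩ | ⟨-, h⟩
      · cases l with
        | nil => left; simpa using hl
        | cons z l =>
          rw [List.isChain_cons_cons] at hc
          obtain ⟨⟨u', hu', -⟩, -⟩ := hc
          exact Or.inr ⟨u', hu'⟩
      · exact hg2 v w h

theorem IsLinking.augment {I : Set V} {f : V → Option V} (hf : IsLinking Adj B I f) {x y : V}
    (h : ReflTransGen (AltStep Adj f) x y)
    (hy : (∀ u, f u ≠ some y) ∨ ∃ u ∈ B, f u = some y) : insert x (I \ {y}) ∈ LGB Adj B := by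
  obtain ⟨⟨l, hne, hc, hn⟩, h1, h2, -⟩ :=
    exists_of_reach (Adj := AltStep Adj f) (r := AltStep Adj f) (fun _ _ h _ => h) h
  cases l with
  | nil => exact absurd rfl hne
  | cons a l =>
    obtain rfl : a = x := h1
    obtain ⟨g, hg, -⟩ := hf.augment_aux hy l a hc hn h2
    exact hg.mem

open Classical in
theorem IsLinking.combine {I J K R : Set V} {f g : V → Option V} (hf : IsLinking Adj B I f)
    (hg : IsLinking Adj B J g) (hR : ∀ y ∈ R, ∀ w, AltStep Adj f y w → w ∈ R)
    (hRB : ∀ y ∈ R, ∀ u ∈ B, f u ≠ some y) (h1 : ∀ v w, g v = some w → w ∈ R → w ∉ K)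
    (h2 : ∀ v w, f v = some w → w ∉ R → w ∉ K) : K ∈ LGB Adj B := by
  let U : Set V := {u | ∃ y ∈ R, f u = some y}
  have hUR : U ⊆ R := by
    rintro u ⟨y, hy, hu⟩
    exact hR y hy u ⟨u, hu, Or.inl rfl⟩
  have hgU : ∀ v w, v ∈ U → g v = some w → w ∈ R := by
    rintro v w ⟨y, hy, hv⟩ hw
    exact hR y hy w ⟨v, hv, hg.adj v w hw⟩
  let h : V → Option V := fun v => if v ∈ U then g v else f v
  have hU : ∀ v, v ∈ U → h v = g v := fun v hv => if_pos hv
  have hU' : ∀ v, v ∉ U → h v = f v := fun v hv => if_neg hv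
  refine IsLinking.mem (f := h) ⟨?_, ?_, ?_, ?_, ?_⟩
  · intro v w hv
    by_cases hvU : v ∈ U
    · rw [hU v hvU] at hv; exact hg.adj v w hv
    · rw [hU' v hvU] at hv; exact hf.adj v w hv
  · intro v hv
    by_cases hvU : v ∈ U
    · rw [hU v hvU] at hv
      obtain ⟨y, hy, hvy⟩ := hvU
      exact absurd hvy (hRB y hy v (hg.term v hv))
    · rw [hU' v hvU] at hv; exact hf.term v hv
  · have aux : ∀ u v w, u ∈ U → v ∉ U → h u = some w → h v ≠ some w := by
      intro u v w hu hv h1 h2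
      rw [hU u hu] at h1
      rw [hU' v hv] at h2
      exact hv ⟨w, hgU u w hu h1, h2⟩
    intro u v w hu hv
    by_cases huU : u ∈ U <;> by_cases hvU : v ∈ U
    · rw [hU _ huU] at hu; rw [hU _ hvU] at hv; exact hg.inj _ _ _ hu hv
    · exact absurd hv (aux _ _ _ huU hvU hu)
    · exact absurd hu (aux _ _ _ hvU huU hv)
    · rw [hU' _ huU] at hu; rw [hU' _ hvU] at hv; exact hf.inj _ _ _ hu hv
  · intro v w hv
    by_cases hvU : v ∈ U
    · rw [hU v hvU] at hv; exact h1 v w hv (hgU v w hvU hv)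
    · rw [hU' v hvU] at hv; exact h2 v w hv fun hw => hvU ⟨w, hw, hv⟩
  · rintro ⟨s, hs, hh⟩
    by_cases hall : ∀ n, s n ∈ U
    · exact hg.fin ⟨s, hs, fun n => by rw [← hU _ (hall n), hh]⟩
    · push Not at hall
      obtain ⟨N, hN⟩ := hall
      have : ∀ n, s (N + n) ∉ U := by
        intro n
        induction n with
        | zero => exact hN
        | succ n ih =>
          intro hU2
          have := hh (N + n)
          rw [hU' _ ih] at this
          exact ih ⟨_, hUR hU2, this⟩
      refine hf.fin ⟨fun n => s (N + n), fun a b hab => by simpa using hs hab, fun n => ?_⟩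
      rw [← hU' _ (this n), hh]; rfl

theorem LGB_exchange {I J : Set V} (hI : I ∈ LGB Adj B) (hJ : J ∈ LGB Adj B) {y : V}
    (hy : y ∈ I) (hyJ : insert y J ∉ LGB Adj B) :
    ∃ x ∈ J \ I, insert y (J \ {x}) ∈ LGB Adj B := by
  obtain ⟨f, hf⟩ := mem_LGB_iff.1 hJ
  obtain ⟨g, hg⟩ := mem_LGB_iff.1 hI
  by_contra! hc
  let R : Set V := {x | ReflTransGen (AltStep Adj f) y x}
  have hR : ∀ x ∈ R, ∀ w, AltStep Adj f x w → w ∈ R := fun x hx w hw => ReflTransGen.tail hx hw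
  have hyR : y ∈ R := ReflTransGen.refl
  have hRf : ∀ x ∈ R, x ∈ J → x ∈ I := by
    intro x hx hxJ
    by_contra hxI
    exact hc x ⟨hxJ, hxI⟩ (hf.augment hx (Or.inl fun u hu => hf.src _ _ hu hxJ))
  have hnot : ∀ x ∈ R, x ∉ J → ¬ ((∀ u, f u ≠ some x) ∨ ∃ u ∈ B, f u = some x) := by
    intro x hx hxJ h
    have := hf.augment hx h
    rw [Set.sdiff_singleton_eq_self hxJ] at this
    exact hyJ this
  refine hyJ (hf.combine hg (R := R) hR ?_ ?_ ?_)
  · intro x hx u hu h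
    exact hnot x hx (hf.src _ _ h) (Or.inr ⟨u, hu, h⟩)
  · rintro v w hv hwR (rfl | hw)
    · exact hg.src _ _ hv hy
    · exact hg.src _ _ hv (hRf w hwR hw)
  · rintro v w hv hwR (rfl | hw)
    · exact hwR hyR
    · exact hf.src _ _ hv hw

theorem LGB_aug {I J : Set V} (hI : I ∈ LGB Adj B) (hImax : ¬ Maximal (· ∈ LGB Adj B) I)
    (hJ : Maximal (· ∈ LGB Adj B) J) : ∃ x ∈ J \ I, insert x I ∈ LGB Adj B := by
  obtain ⟨z, hzI, hz⟩ : ∃ z, z ∉ I ∧ insert z I ∈ LGB Adj B := by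
    by_contra! hc
    refine hImax ⟨hI, fun K hK hIK => ?_⟩
    intro z hz
    by_contra hzI
    exact hc z hzI (LGB_mono hK (Set.insert_subset hz hIK))
  obtain ⟨f, hf⟩ := mem_LGB_iff.1 hz
  obtain ⟨g, hg⟩ := mem_LGB_iff.1 hJ.prop
  by_contra! hc
  let R : Set V := {x | ∃ j ∈ J \ I, ReflTransGen (AltStep Adj f) j x}
  have hR : ∀ x ∈ R, ∀ w, AltStep Adj f x w → w ∈ R := fun x ⟨j, hj, hx⟩ w hw =>
    ⟨j, hj, ReflTransGen.tail hx hw⟩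
  have hnot : ∀ x ∈ R, x ∉ I → ¬ ((∀ u, f u ≠ some x) ∨ ∃ u ∈ B, f u = some x) := by
    rintro x ⟨j, hj, hx⟩ hxI h
    refine hc j hj (LGB_mono (hf.augment hx h) (Set.insert_subset_insert fun v hv => ?_))
    exact ⟨Or.inr hv, fun h => hxI (h ▸ hv)⟩
  have hzR : z ∉ R := fun h => hnot z h hzI (Or.inl fun u hu => hf.src _ _ hu (Or.inl rfl))
  have : insert z J ∈ LGB Adj B := by
    refine hf.combine hg (R := R) hR ?_ ?_ ?_
    · intro x hx u hu h
      exact hnot x hx (fun hxI => hf.src _ _ h (Or.inr hxI)) (Or.inr ⟨u, hu, h⟩)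
    · rintro v w hv hwR (rfl | hw)
      · exact hzR hwR
      · exact hg.src _ _ hv hw
    · rintro v w hv hwR (rfl | hw)
      · exact hf.src _ _ hv (Or.inl rfl)
      · by_cases hwI : w ∈ I
        · exact hf.src _ _ hv (Or.inr hwI)
        · exact hwR ⟨w, ⟨hw, hwI⟩, .refl⟩
  have hzJ : z ∈ J := hJ.le_of_ge this (Set.subset_insert _ _) (Set.mem_insert _ _)
  exact hc z ⟨hzJ, hzI⟩ hz

theorem empty_mem_LGB : ∅ ∈ LGB Adj B :=
  ⟨fun v => absurd v.2 (Set.notMem_empty _), fun v => absurd v.2 (Set.notMem_empty _),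
    fun v => absurd v.2 (Set.notMem_empty _), fun v => absurd v.2 (Set.notMem_empty _)⟩

theorem LGB_card_aug (n : ℕ) : ∀ {I J : Set V}, I ∈ LGB Adj B → J ∈ LGB Adj B → I.Finite →
    J.Finite → I.ncard < J.ncard → (I \ J).ncard = n → ∃ y ∈ J, y ∉ I ∧ insert y I ∈ LGB Adj B := by
  induction n with
  | zero =>
    intro I J hI hJ hIf hJf hlt h0
    have hsub : I ⊆ J := by
      rw [Set.ncard_eq_zero (hIf.subset Set.sdiff_subset)] at h0
      exact Set.sdiff_eq_empty.1 h0
    obtain ⟨y, hy, hyI⟩ := Set.exists_mem_notMem_of_ncard_lt_ncard hlt hIf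
    exact ⟨y, hy, hyI, LGB_mono hJ (Set.insert_subset hy hsub)⟩
  | succ n ih =>
    intro I J hI hJ hIf hJf hlt hn
    obtain ⟨b, hb, hbI⟩ := Set.exists_mem_notMem_of_ncard_lt_ncard hlt hIf
    by_contra! hc
    obtain ⟨x, ⟨hxI, hxJ⟩, hI'⟩ := LGB_exchange hJ hI hb (hc b hb hbI)
    have hcard : (insert b (I \ {x})).ncard = I.ncard := by
      rw [Set.ncard_insert_of_notMem (fun h => hbI h.1) (hIf.subset Set.sdiff_subset),
        Set.ncard_sdiff_singleton_add_one hxI hIf]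
    have hd : (insert b (I \ {x})) \ J = (I \ J) \ {x} := by
      ext v
      simp only [Set.mem_sdiff, Set.mem_insert_iff, Set.mem_singleton_iff]
      constructor
      · rintro ⟨rfl | h, h2⟩
        · exact absurd hb h2
        · exact ⟨⟨h.1, h2⟩, h.2⟩
      · rintro ⟨⟨h1, h2⟩, h3⟩
        exact ⟨Or.inr ⟨h1, h3⟩, h2⟩
    obtain ⟨c, hcJ, hcI', hK⟩ := ih hI' hJ ((hIf.subset Set.sdiff_subset).insert _) hJf
      (by rwa [hcard]) (by
        rw [hd, Set.ncard_sdiff_singleton_of_mem (show x ∈ I \ J from ⟨hxI, hxJ⟩), hn]; rfl)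
    have hcb : c ≠ b := fun h => hcI' (Or.inl h)
    have hcx : c ≠ x := fun h => hxJ (h ▸ hcJ)
    have hcI : c ∉ I := fun h => hcI' (Or.inr ⟨h, hcx⟩)
    have hsub : ∀ v ∈ I, v ∈ insert x (insert c (insert b (I \ {x}))) := by
      intro v hv
      by_cases hvx : v = x
      · exact Or.inl hvx
      · exact Or.inr (Or.inr (Or.inr ⟨hv, hvx⟩))
    by_cases hKx : insert x (insert c (insert b (I \ {x}))) ∈ LGB Adj B
    · exact hc b hb hbI (LGB_mono hKx (Set.insert_subset (by simp) hsub))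
    · obtain ⟨e, ⟨heK, heI⟩, he⟩ := LGB_exchange hI hK hxI hKx
      have hsub' : ∀ v ∈ I, v ∈ insert x (insert c (insert b (I \ {x})) \ {e}) := by
        intro v hv
        rcases hsub v hv with h | h
        · exact Or.inl h
        · exact Or.inr ⟨h, fun h => heI (h ▸ hv)⟩
      by_cases hec : e = c
      · subst hec
        refine hc b hb hbI (LGB_mono he (Set.insert_subset (Or.inr ⟨?_, ?_⟩) hsub'))
        · simp
        · exact fun h => hcb h.symm
      · refine hc c hcJ hcI (LGB_mono he (Set.insert_subset (Or.inr ⟨?_, ?_⟩) hsub'))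
        · simp
        · exact fun h => hec h.symm

/-- Every finite subset of `F` can be linked to `B`. -/
def FL (Adj : V → V → Prop) (B F : Set V) : Prop := ∀ S ⊆ F, S.Finite → S ∈ LGB Adj B

theorem FL_mono {F F' : Set V} (h : FL Adj B F) (hF : F' ⊆ F) : FL Adj B F' :=
  fun S hS hf => h S (hS.trans hF) hf

theorem FL_of_mem {F : Set V} (h : F ∈ LGB Adj B) : FL Adj B F := fun _ hS _ => LGB_mono h hS

/-- The finitarization of `LGB Adj B`. -/
noncomputable def MT (Adj : V → V → Prop) (B : Set V) : Matroid V :=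
  (IndepMatroid.ofFinitaryCardAugment Set.univ (FL Adj B)
    (fun S hS _ => by rw [Set.subset_empty_iff.1 hS]; exact empty_mem_LGB)
    (fun _ _ h hs => FL_mono h hs)
    (fun I J hI hIf hJ hJf hlt => by
      obtain ⟨y, h1, h2, h3⟩ := LGB_card_aug _ (hI I subset_rfl hIf) (hJ J subset_rfl hJf)
        hIf hJf hlt rfl
      exact ⟨y, h1, h2, FL_of_mem h3⟩)
    (fun _ h S hS hf => h S hS hf S subset_rfl hf)
    (fun _ _ => Set.subset_univ _)).matroid

@[simp] theorem MT_indep {F : Set V} : (MT Adj B).Indep F ↔ FL Adj B F := Iff.rfl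

@[simp] theorem MT_ground : (MT Adj B).E = Set.univ := rfl

instance : (MT Adj B).Finitary := IndepMatroid.ofFinitaryCardAugment_finitary _ _ _ _ _ _ _

theorem mem_closure_of_not_FL {F : Set V} {x : V} (hF : FL Adj B F) :
    x ∈ (MT Adj B).closure F ↔ (FL Adj B (insert x F) → x ∈ F) := by
  rw [Matroid.Indep.mem_closure_iff' (M := MT Adj B) hF]
  simp

theorem exists_cofinite_superset {F I : Set V} (hI : I ∈ LGB Adj B) (hIF : I ⊆ F) (n : ℕ) :
    ∀ J ∈ LGB Adj B, J ⊆ F → (F \ J).Finite → (I \ J).ncard = n →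
    ∃ J' ∈ LGB Adj B, J' ⊆ F ∧ (F \ J').Finite ∧ I ⊆ J' := by
  induction n with
  | zero =>
    intro J hJ hJF hf h0
    rw [Set.ncard_eq_zero (hf.subset (Set.sdiff_subset_sdiff_left hIF))] at h0
    exact ⟨J, hJ, hJF, hf, Set.sdiff_eq_empty.1 h0⟩
  | succ n ih =>
    intro J hJ hJF hf hn
    have hIJ : (I \ J).Nonempty := by
      by_contra h
      rw [Set.not_nonempty_iff_eq_empty.1 h] at hn
      simp at hn
    obtain ⟨y, hyI, hyJ⟩ := hIJ
    by_cases h : insert y J ∈ LGB Adj B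
    · refine ih _ h (Set.insert_subset (hIF hyI) hJF) (hf.subset ?_) ?_
      · exact Set.sdiff_subset_sdiff_right (Set.subset_insert _ _)
      · have : I \ insert y J = (I \ J) \ {y} := by
          ext v; simp only [Set.mem_sdiff, Set.mem_insert_iff, Set.mem_singleton_iff]; tauto
        rw [this, Set.ncard_sdiff_singleton_of_mem (show y ∈ I \ J from ⟨hyI, hyJ⟩), hn]; rfl
    · obtain ⟨x, ⟨hxJ, hxI⟩, hx⟩ := LGB_exchange hI hJ hyI h
      refine ih _ hx (Set.insert_subset (hIF hyI) (Set.sdiff_subset.trans hJF))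
        ((hf.insert x).subset ?_) ?_
      · intro v
        simp only [Set.mem_sdiff, Set.mem_insert_iff, Set.mem_singleton_iff]; tauto
      · have : I \ insert y (J \ {x}) = (I \ J) \ {y} := by
          ext v; simp only [Set.mem_sdiff, Set.mem_insert_iff, Set.mem_singleton_iff]
          have : v = x → v ∉ I := fun h => h ▸ hxI
          tauto
        rw [this, Set.ncard_sdiff_singleton_of_mem (show y ∈ I \ J from ⟨hyI, hyJ⟩), hn]; rfl

theorem encard_sdiff_eq_of_isBasis {M : Matroid V} {X F F' J : Set V} (hF : M.IsBasis F X)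
    (hF' : M.IsBasis F' X) (hJ : J ⊆ F) (hJ' : J ⊆ F') : (F \ J).encard = (F' \ J).encard := by
  have aux : ∀ F F' : Set V, J ⊆ F' →
      (F \ J).encard = (F \ F').encard + ((F ∩ F') \ J).encard := by
    intro F F' h
    rw [← Set.encard_union_eq]
    · congr 1
      ext v
      have := @h v
      simp only [Set.mem_sdiff, Set.mem_union, Set.mem_inter_iff]
      tauto
    · rw [Set.disjoint_left]
      intro v h1 h2
      exact h1.2 h2.1.2
  rw [aux F F' hJ', aux F' F hJ,
    hF.isBase_restrict.encard_sdiff_comm hF'.isBase_restrict, Set.inter_comm]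

theorem LGB_existsMaximal
    (hNF : ∀ F, FL Adj B F → ∃ I ⊆ F, I ∈ LGB Adj B ∧ (F \ I).Finite) (X : Set V) :
    Matroid.ExistsMaximalSubsetProperty (· ∈ LGB Adj B) X := by
  intro I hI hIX
  obtain ⟨F, hF, hIF⟩ := Matroid.Indep.subset_isBasis_of_subset (M := MT Adj B)
    (FL_of_mem hI) hIX (Set.subset_univ _)
  obtain ⟨J0, hJ0F, hJ0, hJ0f⟩ := hNF F hF.indep
  obtain ⟨J, hJ, hJF, hJf, hIJ⟩ := exists_cofinite_superset hI hIF _ J0 hJ0 hJ0F hJ0f rfl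
  have bound : ∀ K ∈ LGB Adj B, J ⊆ K → K ⊆ X → (K \ J).encard ≤ (F \ J).encard := by
    intro K hK hJK hKX
    obtain ⟨F', hF', hKF'⟩ := Matroid.Indep.subset_isBasis_of_subset (M := MT Adj B)
      (FL_of_mem hK) hKX (Set.subset_univ _)
    rw [encard_sdiff_eq_of_isBasis hF hF' hJF (hJK.trans hKF')]
    exact Set.encard_le_encard (Set.sdiff_subset_sdiff_left hKF')
  have hfin : ∀ K ∈ LGB Adj B, J ⊆ K → K ⊆ X → (K \ J).Finite := fun K hK h1 h2 =>
    Set.encard_lt_top_iff.1 ((bound K hK h1 h2).trans_lt (Set.encard_lt_top_iff.2 hJf))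
  let N : Set ℕ := {n | ∃ K ∈ LGB Adj B, J ⊆ K ∧ K ⊆ X ∧ (K \ J).ncard = n}
  have hN : N.Nonempty := ⟨_, J, hJ, subset_rfl, hJF.trans hF.subset, rfl⟩
  have hNb : BddAbove N := by
    refine ⟨(F \ J).ncard, ?_⟩
    rintro n ⟨K, hK, h1, h2, rfl⟩
    exact ENat.toNat_le_toNat (bound K hK h1 h2) (Set.encard_lt_top_iff.2 hJf).ne
  obtain ⟨K, hK, hJK, hKX, hKn⟩ := Nat.sSup_mem hN hNb
  refine ⟨K, hIJ.trans hJK, ⟨hK, hKX⟩, ?_⟩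
  rintro K' ⟨hK', hK'X⟩ hKK'
  have h1 : (K' \ J).ncard ≤ (K \ J).ncard := by
    rw [hKn]
    exact le_csSup hNb ⟨K', hK', hJK.trans hKK', hK'X, rfl⟩
  have h2 := Set.eq_of_subset_of_ncard_le (Set.sdiff_subset_sdiff_left hKK') h1
    (hfin K' hK' (hJK.trans hKK') hK'X)
  intro v hv
  by_cases hvJ : v ∈ J
  · exact hJK hvJ
  · exact (h2.symm ▸ (show v ∈ K' \ J from ⟨hv, hvJ⟩) : v ∈ K \ J).1

theorem exists_matroid_of_nearlyFinitary
    (hNF : ∀ F, FL Adj B F → ∃ I ⊆ F, I ∈ LGB Adj B ∧ (F \ I).Finite) :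
    ∃ M : Matroid V, M.E = Set.univ ∧ ∀ J : Set V, M.Indep J ↔ J ∈ LGB Adj B :=
  ⟨(IndepMatroid.mk Set.univ (· ∈ LGB Adj B) empty_mem_LGB (fun _ _ h hs => LGB_mono h hs)
    (fun _ _ hI hm hJ => LGB_aug hI hm hJ) (fun X _ => LGB_existsMaximal hNF X)
    (fun _ _ => Set.subset_univ _)).matroid, rfl, fun _ => Iff.rfl⟩

/-- There is a path from `v` to `B` that avoids `X`. -/
def AvoidPath (Adj : V → V → Prop) (B X : Set V) (v : V) : Prop :=
  ∃ P : DiPath Adj, P.first = v ∧ P.last ∈ B ∧ ∀ u ∈ P.verts, u ∉ X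

theorem AvoidPath.mono {X Y : Set V} {v : V} (h : AvoidPath Adj B X v) (hY : Y ⊆ X) :
    AvoidPath Adj B Y v := by
  obtain ⟨P, h1, h2, h3⟩ := h
  exact ⟨P, h1, h2, fun u hu huY => h3 u hu (hY huY)⟩

theorem avoidPath_of_reach {X : Set V} {v w : V}
    (h : ReflTransGen (fun a b => Adj a b ∧ b ∉ X) v w) (hv : v ∉ X) (hw : w ∈ B) :
    AvoidPath Adj B X v := by
  obtain ⟨P, h1, h2, h3⟩ := exists_of_reach (Adj := Adj) (fun _ _ h _ => h.1) h
  refine ⟨P, h1, h2 ▸ hw, fun u hu => ?_⟩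
  rcases (h3 u hu).1.cases_tail with h | ⟨_, _, h⟩
  · rw [h]; exact hv
  · exact h.2

theorem AvoidPath.reach {X : Set V} {v : V} (h : AvoidPath Adj B X v) :
    v ∉ X ∧ ∃ w ∈ B, ReflTransGen (fun a b => Adj a b ∧ b ∉ X) v w := by
  obtain ⟨P, rfl, h2, h3⟩ := h
  refine ⟨h3 _ (first_mem P), P.last, h2, ?_⟩
  exact ReflTransGen.mono (fun a b h => ⟨h.1, h3 _ h.2.2⟩) _ _ (reach_of_path P (last_mem P)).1

theorem vdomSet_of_avoid {v : V} (hv : v ∉ B)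
    (h : ∀ X : Set V, X.Finite → v ∉ X → AvoidPath Adj B X v) : VDomSet Adj B v := by
  classical
  let r : DiPath Adj → DiPath Adj → Prop := fun P Q => ∀ x ∈ P.verts, x ∈ Q.verts → x = v
  have : Std.Symm r := ⟨fun P Q h x hx hx' => h x hx' hx⟩
  obtain ⟨P, h1, h2⟩ := exists_seq_of_forall_finset_exists'
    (fun P : DiPath Adj => P.first = v ∧ P.last ∈ B) r (by
      intro s _
      obtain ⟨P, h1, h2, h3⟩ := h ({x | ∃ Q ∈ s, x ∈ Q.verts} \ {v}) (by
        refine Set.Finite.subset (s.finite_toSet.biUnion fun Q _ => Q.verts.finite_toSet) ?_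
        rintro x ⟨⟨Q, hQ, hx⟩, -⟩
        exact Set.mem_biUnion hQ hx) (by simp)
      refine ⟨P, ⟨h1, h2⟩, fun Q hQ x hxQ hxP => ?_⟩
      by_contra hxv
      exact h3 x hxP ⟨⟨Q, hQ, hxQ⟩, hxv⟩)
  refine ⟨P, ?_, fun n => (h1 n).1, fun n => (h1 n).2, fun m n hmn => h2 hmn⟩
  intro m n hmn
  by_contra hne
  have := h2 hne _ (last_mem _) (hmn ▸ last_mem _)
  exact hv (this ▸ (h1 m).2)

theorem rdomSet_of_avoid {R : DiRay Adj}
    (h : ∀ X : Set V, X.Finite → ∃ v ∈ R.vertexSet, AvoidPath Adj B X v) : RDomSet Adj B R := by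
  classical
  let r : DiPath Adj → DiPath Adj → Prop := fun P Q => Disjoint P.vertexSet Q.vertexSet
  have : Std.Symm r := ⟨fun P Q h => h.symm⟩
  obtain ⟨P, h1, h2⟩ := exists_seq_of_forall_finset_exists'
    (fun P : DiPath Adj => P.first ∈ R.vertexSet ∧ P.last ∈ B) r (by
      intro s _
      obtain ⟨v, hv, P, h1, h2, h3⟩ := h {x | ∃ Q ∈ s, x ∈ Q.verts} (by
        refine Set.Finite.subset (s.finite_toSet.biUnion fun Q _ => Q.verts.finite_toSet) ?_
        rintro x ⟨Q, hQ, hx⟩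
        exact Set.mem_biUnion hQ hx)
      refine ⟨P, ⟨h1 ▸ hv, h2⟩, fun Q hQ => Set.disjoint_left.2 fun x hxQ hxP => ?_⟩
      exact h3 x hxP ⟨Q, hQ, hxQ⟩)
  refine ⟨P, ?_, fun n => (h1 n).1, fun n => (h1 n).2, fun m n hmn => h2 hmn⟩
  intro m n hmn
  by_contra hne
  exact Set.disjoint_left.1 (h2 hne) (last_mem _) (hmn ▸ last_mem _)

theorem exists_avoid_of_family {P : ℕ → DiPath Adj} {Y X : Set V}
    (h : ∀ m n, m ≠ n → ∀ x ∈ (P m).vertexSet, x ∈ (P n).vertexSet → x ∈ Y) (hX : X.Finite)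
    (hXY : Disjoint X Y) : ∃ n, ∀ u ∈ (P n).verts, u ∉ X := by
  by_contra! hc
  choose x hx hxX using hc
  obtain ⟨m, -, n, -, hmn, he⟩ := Set.infinite_univ.exists_ne_map_eq_of_mapsTo (f := x)
    (s := Set.univ) (t := X) (fun n _ => hxX n) hX
  exact Set.disjoint_left.1 hXY (hxX m) (h m n hmn _ (hx m) (he ▸ hx n))

theorem avoid_of_vdomSet {v : V} (h : VDomSet Adj B v) {X : Set V} (hX : X.Finite) (hv : v ∉ X) :
    AvoidPath Adj B X v := by
  obtain ⟨P, -, h1, h2, h3⟩ := h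
  obtain ⟨n, hn⟩ := exists_avoid_of_family (Y := {v}) h3 hX (by simpa using hv)
  exact ⟨P n, h1 n, h2 n, hn⟩

theorem avoid_of_rdomSet {R : DiRay Adj} (h : RDomSet Adj B R) {X : Set V} (hX : X.Finite) :
    ∃ v ∈ R.vertexSet, AvoidPath Adj B X v := by
  obtain ⟨P, -, h1, h2, h3⟩ := h
  obtain ⟨n, hn⟩ := exists_avoid_of_family (Y := ∅)
    (fun m n hmn x hx hx' => (Set.disjoint_left.1 (h3 m n hmn) hx hx').elim) hX (by simp)
  exact ⟨_, h1 n, P n, rfl, h2 n, hn⟩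

/-- The digraph obtained by isolating the vertices in `R`. -/
def Del (Adj : V → V → Prop) (R : Set V) (x y : V) : Prop := Adj x y ∧ x ∉ R ∧ y ∉ R

/-- The `f`-orbit of `v` ends after `n` steps. -/
def Ends (f : V → Option V) : ℕ → V → Prop
  | 0, v => f v = none
  | n + 1, v => ∃ w, f v = some w ∧ Ends f n w

theorem exists_ends {f : V → Option V} {v t : V} (h : ReflTransGen (FStep f) v t)
    (ht : f t = none) : ∃ n, Ends f n v := by
  induction h using ReflTransGen.head_induction_on with
  | refl => exact ⟨0, ht⟩
  | head h1 _ ih => obtain ⟨n, hn⟩ := ih; exact ⟨n + 1, _, h1, hn⟩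

open Classical in
theorem Ends.update {g : V → Option V} {h : V} (hh : ∀ u, g u ≠ some h) (c : Option V) :
    ∀ n x, x ≠ h → Ends g n x → Ends (Function.update g h c) n x
  | 0, x, hx, he => by
    change Function.update g h c x = none
    rw [Function.update_of_ne hx]; exact he
  | n + 1, x, hx, ⟨w, hw, he⟩ =>
    ⟨w, by rw [Function.update_of_ne hx]; exact hw,
      Ends.update hh c n w (fun h => hh x (h ▸ hw)) he⟩

theorem IsLinking.del_fixed {R I : Set V} {g : V → Option V}
    (hg : IsLinking (Del Adj R) (B \ R) I g) {v : V} (hv : v ∈ R) : g v = some v := by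
  cases h : g v with
  | none => exact absurd hv (hg.term v h).2
  | some w =>
    rcases hg.adj v w h with rfl | h
    · rfl
    · exact absurd hv h.2.1

theorem IsLinking.notMem_of_del {R I : Set V} {g : V → Option V}
    (hg : IsLinking (Del Adj R) (B \ R) I g) {v : V} (hv : v ∈ I) : v ∉ R :=
  fun hR => hg.src _ _ (hg.del_fixed hR) hv

theorem IsLinking.del_mono {R R' I : Set V} {g : V → Option V}
    (hg : IsLinking (Del Adj R') (B \ R') I g) (hR : R ⊆ R') :
    IsLinking (Del Adj R) (B \ R) I g :=
  { hg with
    adj := fun v w h => (hg.adj v w h).imp_right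
      fun h => ⟨h.1, fun h' => h.2.1 (hR h'), fun h' => h.2.2 (hR h')⟩
    term := fun v h => ⟨(hg.term v h).1, fun h' => (hg.term v h).2 (hR h')⟩ }

open Classical in
theorem IsLinking.del_insert {R I K : Set V} {g : V → Option V} {h : V}
    (hg : IsLinking (Del Adj R) (B \ R) I g) (hh : ∀ u, g u ≠ some h) (hK : h ∉ K)
    (hK' : ∀ v w, v ≠ h → g v = some w → w ∉ K) :
    IsLinking (Del Adj (insert h R)) (B \ insert h R) K (Function.update g h (some h)) := by
  have key : ∀ v w, Function.update g h (some h) v = some w →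
      (v = h ∧ w = h) ∨ (v ≠ h ∧ w ≠ h ∧ g v = some w) := by
    intro v w hv
    by_cases hvh : v = h
    · subst hvh; left; simpa using hv.symm
    · rw [Function.update_of_ne hvh] at hv
      exact Or.inr ⟨hvh, fun h => hh v (h ▸ hv), hv⟩
  refine ⟨?_, ?_, ?_, ?_, fin_update hg.fin _ _⟩
  · intro v w hv
    rcases key v w hv with ⟨rfl, rfl⟩ | ⟨h1, h2, h3⟩
    · exact Or.inl rfl
    · rcases hg.adj v w h3 with h | ⟨h4, h5, h6⟩
      · exact Or.inl h
      · exact Or.inr ⟨h4, by simp [h1, h5], by simp [h2, h6]⟩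
  · intro v hv
    by_cases hvh : v = h
    · subst hvh; simp at hv
    · rw [Function.update_of_ne hvh] at hv
      have := hg.term v hv
      exact ⟨this.1, by simp [hvh, this.2]⟩
  · intro a b w ha hb
    rcases key a w ha with ⟨rfl, rfl⟩ | ⟨h1, h2, h3⟩ <;>
      rcases key b w hb with ⟨h4, h5⟩ | ⟨h4, h5, h6⟩
    · exact h4.symm
    · exact absurd rfl h5
    · exact absurd h5 h2
    · exact hg.inj _ _ _ h3 h6
  · intro v w hv
    rcases key v w hv with ⟨rfl, rfl⟩ | ⟨h1, -, h3⟩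
    · exact hK
    · exact hK' v w h1 h3

open Classical in
theorem IsLinking.prefix_vertex {R K : Set V} {g : V → Option V} {h w : V}
    (hg : IsLinking (Del Adj (insert h R)) (B \ insert h R) K g) (hw : w ∈ K) (hhw : Adj h w)
    (hR : h ∉ R) :
    IsLinking (Del Adj R) (B \ R) (insert h (K \ {w})) (Function.update g h (some w)) := by
  have hgh : g h = some h := hg.del_fixed (Or.inl rfl)
  have hwR := hg.notMem_of_del hw
  have key : ∀ v u, Function.update g h (some w) v = some u →
      (v = h ∧ u = w) ∨ (v ≠ h ∧ u ≠ h ∧ u ≠ w ∧ g v = some u) := by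
    intro v u hv
    by_cases hvh : v = h
    · subst hvh; left; simpa using hv.symm
    · rw [Function.update_of_ne hvh] at hv
      refine Or.inr ⟨hvh, ?_, ?_, hv⟩
      · rintro rfl; exact hvh (hg.inj _ _ _ hv hgh)
      · rintro rfl; exact hg.src _ _ hv hw
  have hg' := hg.del_mono (Set.subset_insert h R)
  refine ⟨?_, ?_, ?_, ?_, fin_update hg.fin _ _⟩
  · intro v u hv
    rcases key v u hv with ⟨rfl, rfl⟩ | ⟨-, -, -, h3⟩
    · exact Or.inr ⟨hhw, hR, fun h => hwR (Or.inr h)⟩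
    · exact hg'.adj v u h3
  · intro v hv
    by_cases hvh : v = h
    · subst hvh; simp at hv
    · rw [Function.update_of_ne hvh] at hv
      exact hg'.term v hv
  · intro a b u ha hb
    rcases key a u ha with ⟨rfl, rfl⟩ | ⟨h1, h2, h2', h3⟩ <;>
      rcases key b u hb with ⟨h4, h5⟩ | ⟨h4, h5, h5', h6⟩
    · exact h4.symm
    · exact absurd rfl h5'
    · exact absurd h5 h2'
    · exact hg.inj _ _ _ h3 h6
  · intro v u hv hu
    rcases key v u hv with ⟨rfl, rfl⟩ | ⟨h1, h2, -, h3⟩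
    · rcases hu with rfl | hu
      · exact hwR (Or.inl rfl)
      · exact hu.2 rfl
    · rcases hu with rfl | hu
      · exact h2 rfl
      · exact hg.src _ _ h3 hu.1

theorem FL_del_insert {R E : Set V} {h : V} (hE : h ∉ E)
    (hFL : FL (Del Adj R) (B \ R) (insert h E)) : FL (Del Adj (insert h R)) (B \ insert h R) E := by
  classical
  intro S hS hSf
  obtain ⟨g, hg⟩ := mem_LGB_iff.1 (hFL (insert h S) (Set.insert_subset_insert hS) (hSf.insert h))
  exact (hg.del_insert (fun u hu => hg.src _ _ hu (Or.inl rfl)) (fun hh => hE (hS hh))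
    (fun v w _ hv hw => hg.src _ _ hv (Or.inr hw))).mem

open Classical in
theorem IsLinking.del_orbit_aux {R S : Set V} {g : V → Option V} {h c x : V}
    (hg : IsLinking (Del Adj R) (B \ R) (insert h S) g) (hS : h ∉ S) (hc : g h = some c)
    (hx : ReflTransGen (FStep g) c x) :
    ∃ g', IsLinking (Del Adj (insert h R)) (B \ insert h R) (insert x S) g' ∧ g' x = g x ∧
      ∀ v, g' v = g v ∨ g' v = some v := by
  have hh : ∀ u, g u ≠ some h := fun u hu => hg.src _ _ hu (Or.inl rfl)
  induction hx with
  | refl =>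
    have hch : c ≠ h := fun h' => hh h (h' ▸ hc)
    refine ⟨_, hg.del_insert (K := insert c S) hh ?_ ?_, Function.update_of_ne hch _ _, ?_⟩
    · rintro (h | h)
      · exact hch h.symm
      · exact hS h
    · rintro v w hvh hv (rfl | hw)
      · exact hvh (hg.inj _ _ _ hv hc)
      · exact hg.src _ _ hv (Or.inr hw)
    · intro v
      by_cases hv : v = h
      · subst hv; right; simp
      · left; exact Function.update_of_ne hv _ _
  | @tail x y hcx hxy ih =>
    obtain ⟨g', h1, h2, h3⟩ := ih
    have hxy' : g' x = some y := h2.trans hxy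
    have hx' : ∀ u, g' u ≠ some x := fun u hu => h1.src _ _ hu (Or.inl rfl)
    have hyx : y ≠ x := fun h => hx' x (h ▸ hxy')
    have hyS : y ∉ S := fun h => h1.src _ _ hxy' (Or.inr h)
    have hxS : x ∉ S := by
      intro hxS
      rcases hcx.cases_tail with h' | ⟨u, _, hu⟩
      · exact hg.src _ _ hc (Or.inr (h' ▸ hxS))
      · exact hg.src _ _ hu (Or.inr hxS)
    refine ⟨_, (h1.del_insert (K := insert y S) hx' ?_ ?_).del_mono (Set.subset_insert _ _), ?_, ?_⟩
    · rintro (h | h)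
      · exact hyx h.symm
      · exact hxS h
    · rintro v w hvx hv (rfl | hw)
      · exact hvx (h1.inj _ _ _ hv hxy')
      · exact h1.src _ _ hv (Or.inr hw)
    · rw [Function.update_of_ne hyx]
      rcases h3 y with h | h
      · exact h
      · exact absurd (h1.inj _ _ _ h hxy') hyx
    · intro v
      by_cases hv : v = x
      · subst hv; right; simp
      · rw [Function.update_of_ne hv]; exact h3 v

theorem IsLinking.del_orbit {R S : Set V} {g : V → Option V} {h x : V}
    (hg : IsLinking (Del Adj R) (B \ R) (insert h S) g) (hS : h ∉ S)
    (hx : ReflTransGen (FStep g) h x) (hxh : x ≠ h) :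
    insert x S ∈ LGB (Del Adj (insert h R)) (B \ insert h R) ∧ x ∉ S := by
  refine ⟨?_, ?_⟩
  · rcases hx.cases_head with h' | ⟨c, hc, hcx⟩
    · exact absurd h'.symm hxh
    · obtain ⟨g', hg', -⟩ := hg.del_orbit_aux hS hc hcx
      exact hg'.mem
  · intro hxS
    rcases hx.cases_tail with h' | ⟨u, _, hu⟩
    · exact hxh h'
    · exact hg.src _ _ hu (Or.inr hxS)

section

/-- The successors outside `R` of vertices in `R`. -/
def heads (R : Set V) (f : V → Option V) : Set V := {w | w ∉ R ∧ ∃ v ∈ R, f v = some w}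

/-- The vertices outside `R` at which paths remain to be constructed. -/
def Cur (A R : Set V) (f : V → Option V) : Set V := (A \ R) ∪ heads R f

/-- `f` restricted to the finite set `R` describes initial segments of disjoint paths,
whose continuations can be finitely linked in the complement of `R`. -/
structure Pre (Adj : V → V → Prop) (B A R : Set V) (f : V → Option V) : Prop where
  finR : R.Finite
  term : ∀ v ∈ R, f v = none → v ∈ B
  adj : ∀ v ∈ R, ∀ w, f v = some w → Adj v w
  inj : ∀ u ∈ R, ∀ v ∈ R, ∀ w, f u = some w → f v = some w → u = v
  src : ∀ v ∈ R, ∀ w, f v = some w → w ∉ A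
  fl : FL (Del Adj R) (B \ R) (Cur A R f)

variable {A R : Set V} {f : V → Option V}

theorem notMem_of_mem_Cur {h : V} (hh : h ∈ Cur A R f) : h ∉ R := by
  rcases hh with hh | hh
  · exact hh.2
  · exact hh.1

theorem Pre.heads_eq (hp : Pre Adj B A R f) : heads R f = Cur A R f \ A := by
  ext w
  constructor
  · rintro ⟨h1, v, hv, h2⟩
    exact ⟨Or.inr ⟨h1, v, hv, h2⟩, hp.src v hv w h2⟩
  · rintro ⟨h | h, hA⟩
    · exact absurd h.1 hA
    · exact h

theorem heads_finite (hR : R.Finite) : (heads R f).Finite := by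
  have : heads R f ⊆ ⋃ v ∈ R, {w | f v = some w} := by
    rintro w ⟨-, v, hv, h⟩
    exact Set.mem_biUnion hv h
  refine (hR.biUnion fun v _ => Set.Subsingleton.finite ?_).subset this
  intro a ha b hb
  exact Option.some.inj (ha.symm.trans hb)

section
open Classical

theorem Cur_complete {h : V} (hh : h ∈ Cur A R f) :
    Cur A (insert h R) (Function.update f h none) = Cur A R f \ {h} := by
  have hhR := notMem_of_mem_Cur hh
  ext w
  constructor
  · rintro (⟨h1, h2⟩ | ⟨h1, v, hv, h2⟩)
    · exact ⟨Or.inl ⟨h1, fun h => h2 (Or.inr h)⟩, fun h => h2 (Or.inl h)⟩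
    · by_cases hvh : v = h
      · subst hvh; simp at h2
      · rw [Function.update_of_ne hvh] at h2
        exact ⟨Or.inr ⟨fun h => h1 (Or.inr h), v, hv.resolve_left hvh, h2⟩, fun h => h1 (Or.inl h)⟩
  · rintro ⟨⟨h1, h2⟩ | ⟨h1, v, hv, h2⟩, h3⟩
    · exact Or.inl ⟨h1, fun h => h.elim h3 h2⟩
    · refine Or.inr ⟨fun h => h.elim h3 h1, v, Or.inr hv, ?_⟩
      rw [Function.update_of_ne (by rintro rfl; exact hhR hv)]; exact h2

theorem Cur_advance {h w : V} (hh : h ∈ Cur A R f) (hw : w ∉ insert h R) :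
    Cur A (insert h R) (Function.update f h (some w)) = insert w (Cur A R f \ {h}) := by
  have hhR := notMem_of_mem_Cur hh
  ext u
  constructor
  · rintro (⟨h1, h2⟩ | ⟨h1, v, hv, h2⟩)
    · exact Or.inr ⟨Or.inl ⟨h1, fun h => h2 (Or.inr h)⟩, fun h => h2 (Or.inl h)⟩
    · by_cases hvh : v = h
      · subst hvh; left; simpa using h2.symm
      · rw [Function.update_of_ne hvh] at h2
        exact Or.inr ⟨Or.inr ⟨fun h => h1 (Or.inr h), v, hv.resolve_left hvh, h2⟩,
          fun h => h1 (Or.inl h)⟩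
  · rintro (rfl | ⟨⟨h1, h2⟩ | ⟨h1, v, hv, h2⟩, h3⟩)
    · exact Or.inr ⟨hw, h, Or.inl rfl, by simp⟩
    · exact Or.inl ⟨h1, fun h => h.elim h3 h2⟩
    · refine Or.inr ⟨fun h => h.elim h3 h1, v, Or.inr hv, ?_⟩
      rw [Function.update_of_ne (by rintro rfl; exact hhR hv)]; exact h2

theorem Pre.complete (hp : Pre Adj B A R f) {h : V} (hh : h ∈ Cur A R f) (hB : h ∈ B) :
    Pre Adj B A (insert h R) (Function.update f h none) := by
  have hhR := notMem_of_mem_Cur hh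
  have key : ∀ v ∈ insert h R, ∀ w, Function.update f h none v = some w → v ∈ R ∧ f v = some w := by
    intro v hv w h2
    by_cases hvh : v = h
    · subst hvh; simp at h2
    · rw [Function.update_of_ne hvh] at h2
      exact ⟨hv.resolve_left hvh, h2⟩
  refine ⟨hp.finR.insert h, ?_, ?_, ?_, ?_, ?_⟩
  · intro v hv h2
    by_cases hvh : v = h
    · exact hvh ▸ hB
    · rw [Function.update_of_ne hvh] at h2
      exact hp.term v (hv.resolve_left hvh) h2
  · intro v hv w h2
    obtain ⟨h3, h4⟩ := key v hv w h2
    exact hp.adj v h3 w h4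
  · intro u hu v hv w h1 h2
    obtain ⟨h3, h4⟩ := key v hv w h2
    obtain ⟨h5, h6⟩ := key u hu w h1
    exact hp.inj u h5 v h3 w h6 h4
  · intro v hv w h2
    obtain ⟨h3, h4⟩ := key v hv w h2
    exact hp.src v h3 w h4
  · rw [Cur_complete hh]
    refine FL_del_insert (by simp) ?_
    rw [Set.insert_sdiff_singleton, Set.insert_eq_of_mem hh]
    exact hp.fl

theorem Pre.advance (hp : Pre Adj B A R f) {h w : V} (hh : h ∈ Cur A R f) (hw : w ∉ insert h R)
    (hwC : w ∉ Cur A R f) (hhw : Adj h w)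
    (hfl : FL (Del Adj (insert h R)) (B \ insert h R) (insert w (Cur A R f \ {h}))) :
    Pre Adj B A (insert h R) (Function.update f h (some w)) := by
  have hhR := notMem_of_mem_Cur hh
  have key : ∀ v ∈ insert h R, ∀ u, Function.update f h (some w) v = some u →
      (v = h ∧ u = w) ∨ (u ≠ w ∧ v ∈ R ∧ f v = some u) := by
    intro v hv u h2
    by_cases hvh : v = h
    · subst hvh; left; simpa using h2.symm
    · rw [Function.update_of_ne hvh] at h2
      have hvR := hv.resolve_left hvh
      refine Or.inr ⟨?_, hvR, h2⟩
      rintro rfl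
      exact hwC (Or.inr ⟨fun h => hw (Or.inr h), v, hvR, h2⟩)
  refine ⟨hp.finR.insert h, ?_, ?_, ?_, ?_, ?_⟩
  · intro v hv h2
    by_cases hvh : v = h
    · subst hvh; simp at h2
    · rw [Function.update_of_ne hvh] at h2
      exact hp.term v (hv.resolve_left hvh) h2
  · intro v hv u h2
    rcases key v hv u h2 with ⟨rfl, rfl⟩ | ⟨-, h3, h4⟩
    · exact hhw
    · exact hp.adj v h3 u h4
  · intro a ha v hv u h1 h2
    rcases key v hv u h2 with ⟨rfl, rfl⟩ | ⟨h3, h3', h4⟩ <;>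
      rcases key a ha u h1 with ⟨h5, h6⟩ | ⟨h5, h5', h6⟩
    · exact h5
    · exact absurd rfl h5
    · exact absurd h6 h3
    · exact hp.inj a h5' v h3' u h6 h4
  · intro v hv u h2
    rcases key v hv u h2 with ⟨rfl, rfl⟩ | ⟨-, h3, h4⟩
    · exact fun hA => hwC (Or.inl ⟨hA, fun h => hw (Or.inr h)⟩)
    · exact hp.src v h3 u h4
  · rw [Cur_advance hh hw]
    exact hfl

theorem closure_transfer {T X : Set V} {h w : V} (hT : T.Finite) (hwT : w ∉ T) (hhw : Adj h w)
    (hhR : h ∉ R)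
    (hFL : FL (Del Adj R) (B \ R) (insert h T))
    (hX : X ⊆ (MT (Del Adj R) (B \ R)).closure (insert h T))
    (hFL' : FL (Del Adj (insert h R)) (B \ insert h R) (insert w T)) :
    X ⊆ (MT (Del Adj (insert h R)) (B \ insert h R)).closure (insert w T) := by
  intro x hx
  rw [mem_closure_of_not_FL hFL']
  intro hxFL
  by_contra hxT
  obtain ⟨g, hg⟩ := mem_LGB_iff.1 (hxFL _ subset_rfl ((hT.insert w).insert x))
  have hxR := hg.notMem_of_del (Or.inl rfl)
  have hg' := (hg.prefix_vertex (w := w) (Or.inr (Or.inl rfl)) hhw hhR).mem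
  have hsub : insert x (insert h T) ⊆ insert h (insert x (insert w T) \ {w}) := by
    rintro v (rfl | rfl | hv)
    · exact Or.inr ⟨Or.inl rfl, fun h => hxT (Or.inl h)⟩
    · exact Or.inl rfl
    · exact Or.inr ⟨Or.inr (Or.inr hv), fun h : v = w => hwT (h ▸ hv)⟩
  have := (mem_closure_of_not_FL hFL).1 (hX hx) (FL_of_mem (LGB_mono hg' hsub))
  rcases this with rfl | h
  · exact hxR (Or.inl rfl)
  · exact hxT (Or.inr h)

/-- Extend the partial paths at `h` until they end or until a vertex `z` is reached from which
there is a path to `B` avoiding the given finite set `X`. -/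
theorem move_aux {X : Set V} (hXf : X.Finite) (n : ℕ) :
    ∀ {R E T : Set V} {f g : V → Option V} {h : V}, Pre Adj B A R f → h ∈ Cur A R f → h ∉ E →
    Cur A R f \ {h} ⊆ E → FL (Del Adj R) (B \ R) (insert h E) → T ⊆ E → T.Finite →
    IsLinking (Del Adj R) (B \ R) (insert h T) g → Ends g n h →
    X ⊆ (MT (Del Adj R) (B \ R)).closure (insert h T) →
    ∃ R' f', Pre Adj B A R' f' ∧ R ⊆ R' ∧ (∀ v ∈ R, f' v = f v) ∧
      ((h ∈ R' ∧ Cur A R' f' = Cur A R f \ {h}) ∨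
      ∃ z, z ∉ Cur A R f \ {h} ∧ Cur A R' f' = insert z (Cur A R f \ {h}) ∧ (z = h ∨ h ∈ R') ∧
        ∃ Q : DiPath Adj, Q.first = z ∧ Q.last ∈ B ∧ ∀ u ∈ Q.verts, u ∉ X \ {z}) := by
  induction n with
  | zero =>
    intro R E T f g h hp hh hhE hCE hFL hTE hTf hg he hX
    exact ⟨_, _, hp.complete hh (hg.term h he).1, Set.subset_insert _ _,
      fun v hv => Function.update_of_ne (by rintro rfl; exact notMem_of_mem_Cur hh hv) _ _,
      Or.inl ⟨Or.inl rfl, Cur_complete hh⟩⟩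
  | succ n ih =>
    intro R E T f g h hp hh hhE hCE hFL hTE hTf hg he hX
    obtain ⟨w, hw, he⟩ := he
    have hhR := notMem_of_mem_Cur hh
    have hhg : ∀ u, g u ≠ some h := fun u hu => hg.src _ _ hu (Or.inl rfl)
    have hwh : w ≠ h := fun h' => hhg h (h' ▸ hw)
    have hwT : w ∉ T := fun h' => hg.src _ _ hw (Or.inr h')
    obtain ⟨hhw, -, hwR⟩ := (hg.adj h w hw).resolve_left hwh
    have hg' := hg.del_insert (K := insert w T) hhg (by
        rintro (h' | h')
        · exact hwh h'.symm
        · exact hhE (hTE h')) (by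
        rintro v u hvh hv (rfl | hu)
        · exact hvh (hg.inj _ _ _ hv hw)
        · exact hg.src _ _ hv (Or.inr hu))
    have hX' := closure_transfer hTf hwT hhw hhR (FL_of_mem hg.mem) hX (FL_of_mem hg'.mem)
    have hE' := FL_del_insert hhE hFL
    by_cases hwE : w ∈ (MT (Del Adj (insert h R)) (B \ insert h R)).closure E
    · refine ⟨R, f, hp, subset_rfl, fun _ _ => rfl, Or.inr ⟨h, by simp, ?_, Or.inl rfl, ?_⟩⟩
      · rw [Set.insert_sdiff_singleton, Set.insert_eq_of_mem hh]
      · have hXE : X ⊆ (MT (Del Adj (insert h R)) (B \ insert h R)).closure E := by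
          refine hX'.trans (Matroid.closure_subset_closure_of_subset_closure ?_)
          exact Set.insert_subset hwE (hTE.trans (Matroid.subset_closure _ _ (Set.subset_univ _)))
        obtain ⟨S, hSE, hSf, hSi, hXS⟩ :=
          Matroid.exists_subset_finite_closure_of_subset_closure hXf hXE
        obtain ⟨k, hk⟩ := mem_LGB_iff.1 (hFL _ (Set.insert_subset_insert hSE) (hSf.insert h))
        obtain ⟨Q, h1, h2, h3, -⟩ := hk.exists_path (i := h)
          (fun u hu => hk.src _ _ hu (Or.inl rfl))
        obtain ⟨P, h4, h5, h6⟩ : ∃ P : DiPath Adj, P.first = h ∧ P.last ∈ B ∧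
            ∀ v ∈ P.verts, ReflTransGen (FStep k) h v :=
          ⟨⟨Q.verts, Q.ne, List.IsChain.imp (fun _ _ h => h.1) Q.chain, Q.nodup⟩, h1, h2.1, h3⟩
        refine ⟨P, h4, h5, ?_⟩
        rintro x hx ⟨hxX, hxh⟩
        obtain ⟨h7, h8⟩ := hk.del_orbit (fun hS => hhE (hSE hS)) (h6 x hx) hxh
        exact h8 ((mem_closure_of_not_FL hSi).1 (hXS hxX) (FL_of_mem h7))
    · have hwE' : FL (Del Adj (insert h R)) (B \ insert h R) (insert w E) ∧ w ∉ E := by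
        rw [mem_closure_of_not_FL hE'] at hwE
        push Not at hwE
        exact hwE
      have hwR' : w ∉ insert h R := by
        rintro (h' | h')
        · exact hwh h'
        · exact hwR h'
      have hwC : w ∉ Cur A R f := fun h' => hwE'.2 (hCE ⟨h', hwh⟩)
      have hCw := Cur_advance hh hwR'
      have hCw' : insert w (Cur A R f \ {h}) \ {w} = Cur A R f \ {h} := by
        rw [Set.insert_sdiff_of_mem _ (Set.mem_singleton w)]
        exact Set.sdiff_singleton_eq_self fun h' => hwC h'.1
      obtain ⟨R', f', h1, h2, h3, h4⟩ := ih (hp.advance hh hwR' hwC hhw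
          (FL_mono hwE'.1 (Set.insert_subset_insert hCE)))
        (by rw [hCw]; exact Or.inl rfl) hwE'.2 (by rw [hCw, hCw']; exact hCE) hwE'.1 hTE hTf hg'
        (Ends.update hhg _ _ _ hwh he) hX'
      rw [hCw, hCw'] at h4
      refine ⟨R', f', h1, (Set.subset_insert _ _).trans h2, fun v hv => ?_, ?_⟩
      · rw [h3 v (Or.inr hv), Function.update_of_ne (by rintro rfl; exact hhR hv)]
      · rcases h4 with ⟨-, h4⟩ | ⟨z, hz, h4, -, h5⟩
        · exact Or.inl ⟨h2 (Or.inl rfl), h4⟩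
        · exact Or.inr ⟨z, hz, h4, Or.inr (h2 (Or.inl rfl)), h5⟩

theorem Pre.move {X : Set V} (hXf : X.Finite) {h : V} (hp : Pre Adj B A R f)
    (hh : h ∈ Cur A R f) :
    ∃ R' f', Pre Adj B A R' f' ∧ R ⊆ R' ∧ (∀ v ∈ R, f' v = f v) ∧
      ((h ∈ R' ∧ Cur A R' f' = Cur A R f \ {h}) ∨
      ∃ z, z ∉ Cur A R f \ {h} ∧ Cur A R' f' = insert z (Cur A R f \ {h}) ∧ (z = h ∨ h ∈ R') ∧
        ∃ Q : DiPath Adj, Q.first = z ∧ Q.last ∈ B ∧ ∀ u ∈ Q.verts, u ∉ X \ {z}) := by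
  obtain ⟨F, hF, hCF⟩ := Matroid.Indep.exists_isBase_superset (M := MT (Del Adj R) (B \ R)) hp.fl
  obtain ⟨T, hTF, hTf, -, hXT⟩ := Matroid.exists_subset_finite_closure_of_subset_closure
    (M := MT (Del Adj R) (B \ R)) hXf (Y := F) (by rw [hF.closure_eq]; exact Set.subset_univ _)
  have hFL : FL (Del Adj R) (B \ R) F := hF.indep
  have hT : insert h (T \ {h}) = insert h T := Set.insert_sdiff_singleton
  obtain ⟨g, hg⟩ := mem_LGB_iff.1 (hFL (insert h (T \ {h}))
    (by rw [hT]; exact Set.insert_subset (hCF hh) hTF) ((hTf.subset Set.sdiff_subset).insert h))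
  obtain ⟨t, ht, ht'⟩ := hg.ends (i := h) fun u hu => hg.src _ _ hu (Or.inl rfl)
  obtain ⟨n, hn⟩ := exists_ends ht ht'
  refine move_aux hXf n hp hh (E := F \ {h}) (by simp) (Set.sdiff_subset_sdiff_left hCF) ?_
    (Set.sdiff_subset_sdiff_left hTF) (hTf.subset Set.sdiff_subset) hg hn ?_
  · rw [Set.insert_sdiff_singleton, Set.insert_eq_of_mem (hCF hh)]; exact hFL
  · rw [hT]
    exact hXT.trans (Matroid.closure_subset_closure _ (Set.subset_insert _ _))

end

end

end

section
variable {V : Type*} {Adj : V → V → Prop} {B A : Set V}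

/-- Initial segments of disjoint paths together with a finite set of paths to `B`, almost
disjoint, one starting at the end of each initial segment. -/
structure DState (Adj : V → V → Prop) (B A : Set V) where
  R : Set V
  f : V → Option V
  Q : Set (DiPath Adj)
  pre : Pre Adj B A R f
  finQ : Q.Finite
  lastQ : ∀ P ∈ Q, P.last ∈ B
  meet : ∀ P ∈ Q, ∀ P' ∈ Q, P ≠ P' → ∀ x ∈ P.verts, x ∈ P'.verts → x = P.first ∨ x = P'.first
  injFirst : ∀ P ∈ Q, ∀ P' ∈ Q, P.first = P'.first → P = P'
  firsts : ∀ P ∈ Q, P.first ∈ R ∪ heads R f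
  headsQ : ∀ w ∈ heads R f, ∃ P ∈ Q, P.first = w

/-- The state `t` extends the state `s`. -/
structure DState.Le (s t : DState Adj B A) : Prop where
  R : s.R ⊆ t.R
  f : ∀ v ∈ s.R, t.f v = s.f v
  Q : s.Q ⊆ t.Q

theorem DState.Le.refl (s : DState Adj B A) : s.Le s := ⟨subset_rfl, fun _ _ => rfl, subset_rfl⟩

theorem DState.Le.trans {s t u : DState Adj B A} (h : s.Le t) (h' : t.Le u) : s.Le u :=
  ⟨h.R.trans h'.R, fun v hv => (h'.f v (h.R hv)).trans (h.f v hv), h.Q.trans h'.Q⟩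

open Classical in
theorem DState.process_vertex (hdom : ∀ v, v ∉ B → ¬ VDomSet Adj B v) (s : DState Adj B A) {h : V}
    (hh : h ∈ Cur A s.R s.f) :
    ∃ t : DState Adj B A, s.Le t ∧ h ∈ t.R ∧ Cur A s.R s.f \ {h} ⊆ Cur A t.R t.f := by
  have hhR := notMem_of_mem_Cur hh
  have hfirsts : ∀ R' f', Pre Adj B A R' f' → s.R ⊆ R' → h ∈ R' →
      Cur A s.R s.f \ {h} ⊆ Cur A R' f' → ∀ P ∈ s.Q, P.first ∈ R' ∪ heads R' f' := by
    intro R' f' hp' hR' hhR' hC P hP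
    rcases s.firsts P hP with h1 | h1
    · exact Or.inl (hR' h1)
    · by_cases hPh : P.first = h
      · exact Or.inl (hPh ▸ hhR')
      · rw [s.pre.heads_eq] at h1
        rw [hp'.heads_eq]
        exact Or.inr ⟨hC ⟨h1.1, hPh⟩, h1.2⟩
  by_cases hB : h ∈ B
  · have hC := Cur_complete hh
    have hp := s.pre.complete hh hB
    refine ⟨⟨_, _, s.Q, hp, s.finQ, s.lastQ, s.meet, s.injFirst,
      hfirsts _ _ hp (Set.subset_insert _ _) (Or.inl rfl) hC.symm.subset, ?_⟩,
      ⟨Set.subset_insert _ _, ?_, subset_rfl⟩, Or.inl rfl, hC.symm.subset⟩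
    · intro w hw
      rw [hp.heads_eq, hC] at hw
      exact s.headsQ w (by rw [s.pre.heads_eq]; exact ⟨hw.1.1, hw.2⟩)
    · exact fun v hv => Function.update_of_ne (fun h' : v = h => hhR (h' ▸ hv)) _ _
  · obtain ⟨Sep, hSf, hhS, hSep⟩ : ∃ X : Set V, X.Finite ∧ h ∉ X ∧ ¬ AvoidPath Adj B X h := by
      by_contra! hc
      exact hdom h hB (vdomSet_of_avoid hB hc)
    obtain ⟨R', f', hp, h2, h3, h4⟩ := s.pre.move
      (X := Sep ∪ ⋃ P ∈ s.Q, {v | v ∈ P.verts})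
      (hSf.union (s.finQ.biUnion fun P _ => P.verts.finite_toSet)) hh
    rcases h4 with ⟨hhR', hC⟩ | ⟨z, hz, hC, hzh, Q, hQ1, hQ2, hQ3⟩
    · refine ⟨⟨R', f', s.Q, hp, s.finQ, s.lastQ, s.meet, s.injFirst,
        hfirsts _ _ hp h2 hhR' hC.symm.subset, ?_⟩,
        ⟨h2, h3, subset_rfl⟩, hhR', hC.symm.subset⟩
      intro w hw
      rw [hp.heads_eq, hC] at hw
      exact s.headsQ w (by rw [s.pre.heads_eq]; exact ⟨hw.1.1, hw.2⟩)
    · have hzh' : z ≠ h := by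
        rintro rfl
        refine hSep ⟨Q, hQ1, hQ2, fun u hu huS => hQ3 u hu ⟨Or.inl huS, ?_⟩⟩
        rintro rfl
        exact hhS huS
      have hhR' := hzh.resolve_left hzh'
      have hzR' : z ∉ R' := notMem_of_mem_Cur (A := A) (f := f') (by rw [hC]; exact Or.inl rfl)
      have hzC : z ∉ Cur A s.R s.f := fun h => hz ⟨h, hzh'⟩
      have hzA : z ∉ A := fun hA => hzC (Or.inl ⟨hA, fun h => hzR' (h2 h)⟩)
      have hsub : Cur A s.R s.f \ {h} ⊆ Cur A R' f' := by rw [hC]; exact Set.subset_insert _ _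
      have hzQ : ∀ P ∈ s.Q, P.first ≠ z := by
        rintro P hP rfl
        rcases s.firsts P hP with h5 | h5
        · exact hzR' (h2 h5)
        · exact hzC (Or.inr h5)
      have hQP : ∀ P ∈ s.Q, ∀ x ∈ Q.verts, x ∈ P.verts → x = Q.first := by
        intro P hP x hx hxP
        by_contra hne
        exact hQ3 x hx ⟨Or.inr (Set.mem_biUnion hP hxP), fun h => hne (h.trans hQ1.symm)⟩
      refine ⟨⟨R', f', insert Q s.Q, hp, s.finQ.insert Q, ?_, ?_, ?_, ?_, ?_⟩,
        ⟨h2, h3, Set.subset_insert _ _⟩, hhR', hsub⟩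
      · rintro P (rfl | hP)
        · exact hQ2
        · exact s.lastQ P hP
      · rintro P (rfl | hP) P' (rfl | hP') hne x hx hx'
        · exact absurd rfl hne
        · exact Or.inl (hQP P' hP' x hx hx')
        · exact Or.inr (hQP P hP x hx' hx)
        · exact s.meet P hP P' hP' hne x hx hx'
      · rintro P (rfl | hP) P' (rfl | hP') he
        · rfl
        · exact absurd (he.symm.trans hQ1) (hzQ P' hP')
        · exact absurd (he.trans hQ1) (hzQ P hP)
        · exact s.injFirst P hP P' hP' he
      · rintro P (rfl | hP)
        · rw [hQ1, hp.heads_eq]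
          exact Or.inr ⟨by rw [hC]; exact Or.inl rfl, hzA⟩
        · exact hfirsts _ _ hp h2 hhR' hsub P hP
      · intro w hw
        rw [hp.heads_eq, hC] at hw
        rcases hw with ⟨rfl | hw, hwA⟩
        · exact ⟨Q, Or.inl rfl, hQ1⟩
        · obtain ⟨P, hP, hPw⟩ := s.headsQ w (by rw [s.pre.heads_eq]; exact ⟨hw.1, hwA⟩)
          exact ⟨P, Or.inr hP, hPw⟩

theorem DState.process (hdom : ∀ v, v ∉ B → ¬ VDomSet Adj B v) {W : Set V} (hW : W.Finite) :
    ∀ s : DState Adj B A, W ⊆ Cur A s.R s.f → ∃ t : DState Adj B A, s.Le t ∧ W ⊆ t.R := by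
  induction W, hW using Set.Finite.induction_on with
  | empty => exact fun s _ => ⟨s, .refl s, Set.empty_subset _⟩
  | @insert a W haW _ ih =>
    intro s hs
    obtain ⟨t, h1, h2, h3⟩ := s.process_vertex hdom (hs (Or.inl rfl))
    obtain ⟨u, h4, h5⟩ := ih t fun w hw => h3 ⟨hs (Or.inr hw), fun h => haW (h ▸ hw)⟩
    exact ⟨u, h1.trans h4, Set.insert_subset (h4.R h2) h5⟩

/-- The limit of an increasing sequence of states. -/
structure Chain (Adj : V → V → Prop) (B A : Set V) where
  s : ℕ → DState Adj B A
  le : ∀ n, (s n).Le (s (n + 1))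
  absorb : ∀ n, heads (s n).R (s n).f ⊆ (s (n + 1)).R

namespace Chain
variable (c : Chain Adj B A)

theorem mono {m n : ℕ} (h : m ≤ n) : (c.s m).Le (c.s n) := by
  induction h with
  | refl => exact .refl _
  | step _ ih => exact ih.trans (c.le _)

def R : Set V := ⋃ n, (c.s n).R

def Q : Set (DiPath Adj) := ⋃ n, (c.s n).Q

open Classical in
noncomputable def f (v : V) : Option V :=
  if h : ∃ n, v ∈ (c.s n).R then (c.s (Nat.find h)).f v else some v

theorem f_eq {n : ℕ} {v : V} (hv : v ∈ (c.s n).R) : c.f v = (c.s n).f v := by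
  classical
  have h : ∃ n, v ∈ (c.s n).R := ⟨n, hv⟩
  unfold f
  rw [dif_pos h]
  have := (c.mono (Nat.find_min' h hv)).f v
  rw [this]
  convert Nat.find_spec h

theorem mem_R {v : V} : v ∈ c.R ↔ ∃ n, v ∈ (c.s n).R := Set.mem_iUnion

theorem f_of_notMem {v : V} (hv : v ∉ c.R) : c.f v = some v := by
  rw [mem_R] at hv
  exact dif_neg hv

theorem mem_R_of_f {v w : V} (hv : v ∈ c.R) (h : c.f v = some w) : w ∈ c.R := by
  obtain ⟨n, hn⟩ := c.mem_R.1 hv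
  rw [c.f_eq hn] at h
  by_cases hw : w ∈ (c.s n).R
  · exact c.mem_R.2 ⟨n, hw⟩
  · exact c.mem_R.2 ⟨n + 1, c.absorb n ⟨hw, v, hn, h⟩⟩

theorem mem_R_of_reach {v w : V} (hv : v ∈ c.R) (h : ReflTransGen (FStep c.f) v w) : w ∈ c.R := by
  induction h with
  | refl => exact hv
  | tail _ h ih => exact c.mem_R_of_f ih h

theorem adj {v w : V} (h : c.f v = some w) : w = v ∨ Adj v w := by
  by_cases hv : v ∈ c.R
  · obtain ⟨n, hn⟩ := c.mem_R.1 hv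
    rw [c.f_eq hn] at h
    exact Or.inr ((c.s n).pre.adj v hn w h)
  · rw [c.f_of_notMem hv] at h
    exact Or.inl (Option.some.inj h).symm

theorem term {v : V} (h : c.f v = none) : v ∈ B := by
  by_cases hv : v ∈ c.R
  · obtain ⟨n, hn⟩ := c.mem_R.1 hv
    rw [c.f_eq hn] at h
    exact (c.s n).pre.term v hn h
  · rw [c.f_of_notMem hv] at h
    simp at h

theorem inj (u v w : V) (hu : c.f u = some w) (hv : c.f v = some w) : u = v := by
  have aux : ∀ u v, u ∈ c.R → v ∉ c.R → c.f u = some w → c.f v ≠ some w := by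
    intro u v huR hvR hu hv
    rw [c.f_of_notMem hvR] at hv
    exact hvR (Option.some.inj hv ▸ c.mem_R_of_f huR hu)
  by_cases huR : u ∈ c.R <;> by_cases hvR : v ∈ c.R
  · obtain ⟨m, hm⟩ := c.mem_R.1 huR
    obtain ⟨n, hn⟩ := c.mem_R.1 hvR
    have hm' := (c.mono (le_max_left m n)).R hm
    have hn' := (c.mono (le_max_right m n)).R hn
    rw [c.f_eq hm'] at hu
    rw [c.f_eq hn'] at hv
    exact (c.s _).pre.inj _ hm' _ hn' w hu hv
  · exact absurd hv (aux u v huR hvR hu)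
  · exact absurd hu (aux v u hvR huR hv)
  · rw [c.f_of_notMem huR] at hu
    rw [c.f_of_notMem hvR] at hv
    exact (Option.some.inj hu).trans (Option.some.inj hv).symm

theorem src {a : V} (ha : a ∈ A) (haR : a ∈ c.R) (u : V) : c.f u ≠ some a := by
  intro h
  by_cases hu : u ∈ c.R
  · obtain ⟨n, hn⟩ := c.mem_R.1 hu
    rw [c.f_eq hn] at h
    exact (c.s n).pre.src u hn a h ha
  · rw [c.f_of_notMem hu] at h
    exact hu (Option.some.inj h ▸ haR)

theorem exists_subset_R {X : Set V} (hX : X.Finite) (hXR : X ⊆ c.R) : ∃ n, X ⊆ (c.s n).R := by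
  induction X, hX using Set.Finite.induction_on with
  | empty => exact ⟨0, Set.empty_subset _⟩
  | insert _ _ ih =>
    obtain ⟨ha, hX⟩ := Set.insert_subset_iff.1 hXR
    obtain ⟨m, hm⟩ := ih hX
    obtain ⟨n, hn⟩ := c.mem_R.1 ha
    exact ⟨max m n, Set.insert_subset ((c.mono (le_max_right m n)).R hn)
      (hm.trans (c.mono (le_max_left m n)).R)⟩

theorem rdomSet {r : DiRay Adj} (h0 : r.f 0 ∈ c.R) (hr : ∀ n, c.f (r.f n) = some (r.f (n + 1))) :
    RDomSet Adj B r := by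
  have hR : ∀ n, r.f n ∈ c.R := fun n => by
    induction n with
    | zero => exact h0
    | succ n ih => exact c.mem_R_of_f ih (hr n)
  obtain ⟨n0, hn0⟩ := c.mem_R.1 h0
  have key : ∀ n ≥ n0, ∃ P ∈ c.Q, P.first ∈ r.vertexSet ∧ P.first ∉ (c.s n).R := by
    intro n hn
    obtain ⟨k, hk, hk'⟩ : ∃ k, r.f k ∈ (c.s n).R ∧ r.f (k + 1) ∉ (c.s n).R := by
      by_contra! hc
      have : ∀ k, r.f k ∈ (c.s n).R := fun k => by
        induction k with
        | zero => exact (c.mono hn).R hn0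
        | succ k ih => exact hc k ih
      exact Set.infinite_of_injective_forall_mem r.inj this (c.s n).pre.finR
    obtain ⟨P, hP, hPk⟩ := (c.s n).headsQ (r.f (k + 1)) ⟨hk', r.f k, hk, by
      rw [← c.f_eq hk]; exact hr k⟩
    exact ⟨P, Set.mem_iUnion.2 ⟨n, hP⟩, ⟨k + 1, hPk.symm⟩, hPk ▸ hk'⟩
  have hinf : {P | P ∈ c.Q ∧ P.first ∈ r.vertexSet}.Infinite := by
    intro hfin
    obtain ⟨N, hN⟩ := c.exists_subset_R (hfin.image DiPath.first) (by
      rintro _ ⟨P, ⟨-, k, hk⟩, rfl⟩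
      exact hk ▸ hR k)
    obtain ⟨P, h1, h2, h3⟩ := key (max n0 N) (le_max_left _ _)
    exact h3 ((c.mono (le_max_right _ _)).R (hN ⟨P, ⟨h1, h2⟩, rfl⟩))
  refine rdomSet_of_avoid fun X hX => ?_
  have hpair : ∀ P ∈ c.Q, ∀ P' ∈ c.Q, (P.first = P'.first → P = P') ∧ (P ≠ P' →
      ∀ x ∈ P.verts, x ∈ P'.verts → x = P.first ∨ x = P'.first) := by
    intro P hP P' hP'
    obtain ⟨m, hm⟩ := Set.mem_iUnion.1 hP
    obtain ⟨n, hn⟩ := Set.mem_iUnion.1 hP'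
    have hm' := (c.mono (le_max_left m n)).Q hm
    have hn' := (c.mono (le_max_right m n)).Q hn
    exact ⟨(c.s _).injFirst P hm' P' hn', (c.s _).meet P hm' P' hn'⟩
  have hhit : {P | P ∈ c.Q ∧ ∃ x ∈ X, x ∈ P.verts}.Finite := by
    refine (hX.biUnion (t := fun x => {P | P ∈ c.Q ∧ P.first = x} ∪
      {P | P ∈ c.Q ∧ x ∈ P.verts ∧ x ≠ P.first}) fun x _ => ?_).subset ?_
    · refine Set.Finite.union (Set.Subsingleton.finite ?_) (Set.Subsingleton.finite ?_)
      · rintro P ⟨hP, hx⟩ P' ⟨hP', hx'⟩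
        exact (hpair P hP P' hP').1 (hx.trans hx'.symm)
      · rintro P ⟨hP, hx, hx1⟩ P' ⟨hP', hx', hx1'⟩
        by_contra hne
        exact ((hpair P hP P' hP').2 hne x hx hx').elim hx1 hx1'
    · rintro P ⟨hP, x, hx, hxP⟩
      refine Set.mem_biUnion hx ?_
      by_cases h : x = P.first
      · exact Or.inl ⟨hP, h.symm⟩
      · exact Or.inr ⟨hP, hxP, h⟩
  obtain ⟨P, ⟨hP, hPr⟩, hPX⟩ := (hinf.sdiff hhit).nonempty
  obtain ⟨n, hn⟩ := Set.mem_iUnion.1 hP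
  exact ⟨_, hPr, P, rfl, (c.s n).lastQ P hn, fun u hu huX => hPX ⟨hP, u, huX, hu⟩⟩

end Chain

end

section
variable {V : Type*} {Adj : V → V → Prop} {B : Set V}

theorem del_empty : Del Adj ∅ = Adj := by
  funext x y
  simp [Del]

theorem cur_empty {A : Set V} {f : V → Option V} : Cur A ∅ f = A := by
  simp [Cur, heads]

/-- The state in which no vertex has been processed. -/
def DState.init {A : Set V} (h : FL Adj B A) : DState Adj B A where
  R := ∅
  f := some
  Q := ∅
  pre :=
    { finR := Set.finite_empty
      term := by simp
      adj := by simp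
      inj := by simp
      src := by simp
      fl := by rwa [del_empty, cur_empty, Set.sdiff_empty] }
  finQ := Set.finite_empty
  lastQ := by simp
  meet := by simp
  injFirst := by simp
  firsts := by simp
  headsQ := by simp [heads]

/-- If `I` is linkable to `B` and `X` is countable, and every finite subset of `I ∪ X` is linkable,
then `I ∪ X` can be joined to `B` by disjoint paths and rays that dominate `B`. -/
theorem exists_mem_LGB_and_rays (hdom : ∀ v, v ∉ B → ¬ VDomSet Adj B v) {I X : Set V}
    (hI : I ∈ LGB Adj B) (hX : X.Countable) (hFL : FL Adj B (I ∪ X)) :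
    ∃ J ⊆ I ∪ X, J ∈ LGB Adj B ∧ ∃ ρ : ↥((I ∪ X) \ J) → DiRay Adj, (∀ a, RDomSet Adj B (ρ a)) ∧
      ∀ a b, a ≠ b → Disjoint (ρ a).vertexSet (ρ b).vertexSet := by
  classical
  obtain ⟨P, hP1, hP2, hP3⟩ := hI
  obtain ⟨e, he⟩ := Set.countable_iff_exists_injOn.1 hX
  set A := I ∪ X with hA
  have step : ∀ (s : DState Adj B A) (n : ℕ), ∃ t : DState Adj B A, s.Le t ∧
      heads s.R s.f ⊆ t.R ∧ (∀ x ∈ X, e x ≤ n → x ∈ t.R) ∧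
      ∀ a : I, (∃ v ∈ (P a).verts, v ∈ s.R) → (a : V) ∈ t.R := by
    intro s n
    obtain ⟨t, h1, h2⟩ := s.process hdom (W := heads s.R s.f ∪ ({x | x ∈ X ∧ e x ≤ n} \ s.R ∪
        (((↑) : I → V) '' {a : I | ∃ v ∈ (P a).verts, v ∈ s.R}) \ s.R)) (by
      refine (heads_finite s.pre.finR).union (.union (.sdiff ?_) (.sdiff (.image _ ?_)))
      · exact Set.Finite.of_injOn (t := Set.Iic n) (fun x hx => hx.2)
          (he.mono fun x hx => hx.1) (Set.finite_Iic n)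
      · refine (s.pre.finR.biUnion (t := fun v => {a : I | v ∈ (P a).verts}) fun v _ =>
          Set.Subsingleton.finite fun a ha b hb => ?_).subset ?_
        · by_contra hab
          exact Set.disjoint_left.1 (hP3 a b hab) ha hb
        · rintro a ⟨v, hv, hvR⟩
          exact Set.mem_biUnion hvR hv)
      (by
      refine Set.union_subset Set.subset_union_right (Set.union_subset ?_ ?_)
      · exact fun x hx => Or.inl ⟨Or.inr hx.1.1, hx.2⟩
      · rintro _ ⟨⟨a, -, rfl⟩, h⟩
        exact Or.inl ⟨Or.inl a.2, h⟩)
    refine ⟨t, h1, fun v hv => h2 (Or.inl hv), fun x hx hn => ?_, fun a ha => ?_⟩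
    · by_cases hxs : x ∈ s.R
      · exact h1.R hxs
      · exact h2 (Or.inr (Or.inl ⟨⟨hx, hn⟩, hxs⟩))
    · by_cases hxs : (a : V) ∈ s.R
      · exact h1.R hxs
      · exact h2 (Or.inr (Or.inr ⟨⟨a, ha, rfl⟩, hxs⟩))
  choose nxt hn1 hn2 hn3 hn4 using step
  let c : Chain Adj B A :=
    { s := fun n => Nat.rec (DState.init hFL) (fun n s => nxt s n) n
      le := fun n => hn1 _ n
      absorb := fun n => hn2 _ n }
  have hXR : X ⊆ c.R := fun x hx => c.mem_R.2 ⟨e x + 1, hn3 _ (e x) x hx le_rfl⟩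
  have hIR : ∀ a : I, (a : V) ∉ c.R → ∀ v ∈ (P a).verts, v ∉ c.R := by
    intro a ha v hv hvR
    obtain ⟨n, hn⟩ := c.mem_R.1 hvR
    exact ha (c.mem_R.2 ⟨n + 1, hn4 _ n a ⟨v, hv, hn⟩⟩)
  have hIn : ∀ a ∈ A, a ∉ c.R → a ∈ I := fun a ha haR => ha.resolve_right fun h => haR (hXR h)
  let J : Set V := {a | a ∈ A ∧ (a ∈ c.R → ∃ t, ReflTransGen (FStep c.f) a t ∧ c.f t = none)}
  have hJR : ∀ a : ↥(A \ J), (a : V) ∈ c.R ∧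
      ∀ t, ReflTransGen (FStep c.f) a t → c.f t ≠ none := by
    rintro ⟨a, haA, haJ⟩
    by_contra! hc
    refine haJ ⟨haA, fun h => ?_⟩
    obtain ⟨t, h1, h2⟩ := hc h
    exact ⟨t, h1, h2⟩
  refine ⟨J, fun a ha => ha.1, ?_, ?_⟩
  · refine mem_LGB_of_rel (fun i v => (i ∈ c.R ∧ ReflTransGen (FStep c.f) i v) ∨
      (i ∉ c.R ∧ ∃ h : i ∈ I, v ∈ (P ⟨i, h⟩).verts)) (fun i hi => ?_) ?_
    · by_cases hiR : i ∈ c.R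
      · obtain ⟨t, h1, h2⟩ := hi.2 hiR
        obtain ⟨p, h3, h4, h5⟩ := exists_of_reach (Adj := Adj) (r := FStep c.f)
          (fun x y hxy hne => (c.adj hxy).resolve_left (Ne.symm hne)) h1
        exact ⟨p, h3, h4 ▸ c.term h2, fun v hv => Or.inl ⟨hiR, (h5 v hv).1⟩⟩
      · have hiI := hIn i hi.1 hiR
        exact ⟨P ⟨i, hiI⟩, hP1 _, hP2 _, fun v hv => Or.inr ⟨hiR, hiI, hv⟩⟩
    · rintro i hi j hj v (⟨h1, h2⟩ | ⟨h1, h2, h3⟩) (⟨h1', h2'⟩ | ⟨h1', h2', h3'⟩)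
      · exact eq_of_reach_of_reach c.inj (c.src hi.1 h1) (c.src hj.1 h1') h2 h2'
      · exact absurd (c.mem_R_of_reach h1 h2) (hIR _ h1' v h3')
      · exact absurd (c.mem_R_of_reach h1' h2') (hIR _ h1 v h3)
      · by_contra hne
        exact Set.disjoint_left.1
          (hP3 ⟨i, h2⟩ ⟨j, h2'⟩ fun h => hne (congrArg Subtype.val h)) h3 h3'
  · have := fun a : ↥(A \ J) => exists_ray_of_not_ends c.inj (c.src a.2.1 (hJR a).1) (hJR a).2
    choose s hs1 hs2 hs3 using this
    refine ⟨fun a => ⟨s a, hs1 a, fun n => (c.adj (hs3 a n)).resolve_left fun h => ?_⟩,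
      fun a => ?_, fun a b hab => Set.disjoint_left.2 ?_⟩
    · exact absurd (hs1 a h) (by simp)
    · exact c.rdomSet (by simpa [hs2] using (hJR a).1) (hs3 a)
    · rintro v ⟨m, hm⟩ ⟨n, hn⟩
      have hreach : ∀ (a : ↥(A \ J)) (n : ℕ), ReflTransGen (FStep c.f) (a : V) (s a n) := by
        intro a n
        induction n with
        | zero => rw [hs2]
        | succ n ih => exact ih.tail (hs3 a n)
      simp only at hm hn
      exact hab (Subtype.ext (eq_of_reach_of_reach c.inj (c.src a.2.1 (hJR a).1)
        (c.src b.2.1 (hJR b).1) (hm ▸ hreach a m) (hn ▸ hreach b n)))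

theorem VDomSet.mono {B' : Set V} {v : V} (h : VDomSet Adj B v) (hB : B ⊆ B') :
    VDomSet Adj B' v := by
  obtain ⟨P, h1, h2, h3, h4⟩ := h
  exact ⟨P, h1, h2, fun n => hB (h3 n), h4⟩

theorem RDomSet.mono {B' : Set V} {r : DiRay Adj} (h : RDomSet Adj B r) (hB : B ⊆ B') :
    RDomSet Adj B' r := by
  obtain ⟨P, h1, h2, h3, h4⟩ := h
  exact ⟨P, h1, h2, fun n => hB (h3 n), h4⟩

theorem reach_last (P : DiPath Adj) {v : V} (hv : v ∈ P.verts) : ReflTransGen Adj v P.last :=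
  ReflTransGen.mono (fun _ _ h => h.1) _ _ (reach_of_path P hv).2

theorem first_reach (P : DiPath Adj) {v : V} (hv : v ∈ P.verts) : ReflTransGen Adj P.first v :=
  ReflTransGen.mono (fun _ _ h => h.1) _ _ (reach_of_path P hv).1

theorem eq_of_reach_of_sink {v w : V} (hv : ∀ y, ¬ Adj v y) (h : ReflTransGen Adj v w) : v = w := by
  rcases h.cases_head with h | ⟨y, h, -⟩
  · exact h
  · exact absurd h (hv y)

theorem not_vdomSet_of_sink {v : V} (hv : ∀ y, ¬ Adj v y) (hvB : v ∉ B) : ¬ VDomSet Adj B v := by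
  rintro ⟨P, -, h1, h2, -⟩
  have := eq_of_reach_of_sink hv (h1 0 ▸ first_reach (P 0) (last_mem _))
  exact hvB (this ▸ h2 0)

theorem exists_trivial_path (Adj : V → V → Prop) (v : V) :
    ∃ P : DiPath Adj, P.first = v ∧ P.last = v ∧ ∀ x ∈ P.verts, x = v :=
  ⟨⟨[v], by simp, List.isChain_singleton v, by simp⟩, rfl, rfl, by simp⟩

theorem mem_LGB_of_subset {I : Set V} (h : I ⊆ B) : I ∈ LGB Adj B := by
  refine mem_LGB_of_rel (fun i v => v = i) (fun i hi => ?_) (fun i _ j _ v h h' => h ▸ h')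
  obtain ⟨P, h1, h2, h3⟩ := exists_trivial_path Adj i
  exact ⟨P, h1, h2 ▸ h hi, h3⟩

theorem union_mem_LGB_of_countable (hdom : ∀ v, v ∉ B → ¬ VDomSet Adj B v)
    (hray : ∀ r : DiRay Adj, ¬ RDomSet Adj B r) {I X : Set V}
    (hI : I ∈ LGB Adj B) (hX : X.Countable) (hFL : FL Adj B (I ∪ X)) : I ∪ X ∈ LGB Adj B := by
  obtain ⟨J, -, hJ2, ρ, hρ, -⟩ := exists_mem_LGB_and_rays hdom hI hX hFL
  refine LGB_mono hJ2 fun a ha => ?_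
  by_contra haJ
  exact hray _ (hρ ⟨a, ha, haJ⟩)

theorem finite_reach (hsink : ∀ b ∈ B, ∀ y, ¬ Adj b y) (hdom : ∀ v, v ∉ B → ¬ VDomSet Adj B v)
    (hray : ∀ r : DiRay Adj, ¬ RDomSet Adj B r) (v : V) :
    {b | b ∈ B ∧ ReflTransGen Adj v b}.Finite := by
  classical
  by_cases hv : v ∈ B
  · exact (Set.finite_singleton v).subset fun b hb => (eq_of_reach_of_sink (hsink v hv) hb.2).symm
  by_contra hinf
  have hmem := union_mem_LGB_of_countable hdom hray (X := {v})
    (mem_LGB_of_subset (Adj := Adj) (B := B) (I := {b | b ∈ B ∧ ReflTransGen Adj v b})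
      fun b hb => hb.1)
    (Set.countable_singleton v) (by
      intro S hS hSf
      obtain ⟨b, ⟨hb, hvb⟩, hbS⟩ := (Set.Infinite.sdiff hinf hSf).nonempty
      obtain ⟨P, h1, h2, -⟩ := exists_of_reach (Adj := Adj) (fun _ _ h _ => h) hvb
      refine mem_LGB_of_rel (fun i x => (i = v ∧ x ∈ P.verts) ∨ (i ≠ v ∧ x = i)) (fun i hi => ?_) ?_
      · by_cases hiv : i = v
        · exact ⟨P, h1.trans hiv.symm, h2 ▸ hb, fun x hx => Or.inl ⟨hiv, hx⟩⟩
        · obtain ⟨p, h3, h4, h5⟩ := exists_trivial_path Adj i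
          exact ⟨p, h3, h4 ▸ ((hS hi).resolve_right hiv).1, fun x hx => Or.inr ⟨hiv, h5 x hx⟩⟩
      · have aux : ∀ j ∈ S, j ≠ v → j ∉ P.verts := by
          intro j hj hjv hjP
          have := eq_of_reach_of_sink (hsink j ((hS hj).resolve_right hjv).1) (reach_last P hjP)
          exact hbS (h2 ▸ this ▸ hj)
        rintro i hi j hj x (⟨h3, h4⟩ | ⟨h3, rfl⟩) (⟨h5, h6⟩ | ⟨h5, rfl⟩)
        · exact h3.trans h5.symm
        · exact absurd h4 (aux _ hj h5)
        · exact absurd h6 (aux _ hi h3)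
        · rfl)
  obtain ⟨P, h1, h2, h3⟩ := hmem
  let v' : ↥({b | b ∈ B ∧ ReflTransGen Adj v b} ∪ {v}) := ⟨v, Or.inr rfl⟩
  have hr := first_reach (P v') (last_mem _)
  rw [h1] at hr
  let b' : ↥({b | b ∈ B ∧ ReflTransGen Adj v b} ∪ {v}) := ⟨(P v').last, Or.inl ⟨h2 _, hr⟩⟩
  refine Set.disjoint_left.1 (h3 v' b' fun h => hv ?_) (last_mem (P v')) ?_
  · have : v = (P v').last := congrArg Subtype.val h
    exact this ▸ h2 v'
  · have := first_mem (P b')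
    rw [h1] at this
    exact this

theorem countable_reach {r : V → V → Prop} (h : ∀ v, {w | r v w}.Countable) (v : V) :
    {w | ReflTransGen r v w}.Countable := by
  let L : ℕ → Set V := fun n => Nat.rec {v} (fun _ s => ⋃ x ∈ s, {w | r x w}) n
  have hL : ∀ n, (L n).Countable := fun n => by
    induction n with
    | zero => exact Set.countable_singleton v
    | succ n ih => exact ih.biUnion fun x _ => h x
  refine (Set.countable_iUnion hL).mono fun w hw => ?_
  induction hw with
  | refl => exact Set.mem_iUnion.2 ⟨0, rfl⟩
  | tail _ h ih =>
    obtain ⟨n, hn⟩ := Set.mem_iUnion.1 ih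
    exact Set.mem_iUnion.2 ⟨n + 1, Set.mem_biUnion hn h⟩

/-- A single choice of end vertices works for all finite subsets of `F`. -/
theorem exists_ends_of_FL {F : Set V} (hF : FL Adj B F)
    (hfin : ∀ v, {b | b ∈ B ∧ ReflTransGen Adj v b}.Finite) :
    ∃ e : F → V, (∀ u : F, e u ∈ B ∧ ReflTransGen Adj u (e u)) ∧ ∀ S : Finset F,
      ∃ p : F → DiPath Adj, (∀ u : F, (p u).first = u) ∧ (∀ u ∈ S, (p u).last = e u) ∧
        ∀ u ∈ S, ∀ w ∈ S, u ≠ w → Disjoint (p u).vertexSet (p w).vertexSet := by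
  classical
  have h1 : ∀ S : Finset F, ∃ p : F → DiPath Adj, (∀ u : F, (p u).first = u) ∧
      (∀ u, (p u).last ∈ B) ∧
      ∀ u ∈ S, ∀ w ∈ S, u ≠ w → Disjoint (p u).vertexSet (p w).vertexSet := by
    intro S
    obtain ⟨P, h1, h2, h3⟩ := hF (Subtype.val '' (S : Set F)) (by simp) (S.finite_toSet.image _)
    have h4 : ∀ u : F, ∃ p : DiPath Adj, p.first = u ∧ p.last ∈ B := by
      intro u
      obtain ⟨P, h1, h2, -⟩ := hF {(u : V)} (by simp) (Set.finite_singleton _)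
      exact ⟨P ⟨u, rfl⟩, h1 _, h2 _⟩
    choose q hq1 hq2 using h4
    have hm : ∀ u ∈ S, (u : V) ∈ Subtype.val '' (S : Set F) := fun u hu => ⟨u, hu, rfl⟩
    refine ⟨fun u => if hu : u ∈ S then P ⟨u, hm u hu⟩ else q u, fun u => ?_, fun u => ?_, ?_⟩
    · dsimp only
      split_ifs with hu
      · exact h1 _
      · exact hq1 u
    · dsimp only
      split_ifs with hu
      · exact h2 _
      · exact hq2 u
    · intro u hu w hw huw
      simp only [hu, hw, dif_pos]
      exact h3 _ _ fun h => huw (Subtype.ext (by simpa using h))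
  choose p hp1 hp2 hp3 using h1
  have hT : ∀ (S : Finset F) (u : F), (p S u).last ∈ {b | b ∈ B ∧ ReflTransGen Adj u b} :=
    fun S u => ⟨hp2 S u, hp1 S u ▸ first_reach _ (last_mem _)⟩
  have : ∀ u : F, Finite {b | b ∈ B ∧ ReflTransGen Adj u b} := fun u => (hfin u).to_subtype
  obtain ⟨χ, hχ⟩ := Finset.rado_selection (α := F)
    (β := fun u => {b | b ∈ B ∧ ReflTransGen Adj u b}) fun S u => ⟨_, hT S u⟩
  refine ⟨fun u => χ u, fun u => (χ u).2, fun S => ?_⟩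
  obtain ⟨t, hSt, ht⟩ := hχ S
  refine ⟨p t, hp1 t, fun u hu => ?_, fun u hu w hw => hp3 t u (hSt hu) w (hSt hw)⟩
  exact (congrArg Subtype.val (ht u hu)).symm

theorem mem_LGB_of_FL (hsink : ∀ b ∈ B, ∀ y, ¬ Adj b y) (hdom : ∀ v, v ∉ B → ¬ VDomSet Adj B v)
    (hray : ∀ r : DiRay Adj, ¬ RDomSet Adj B r) {F : Set V} (hF : FL Adj B F) : F ∈ LGB Adj B := by
  classical
  have hfin := finite_reach hsink hdom hray
  obtain ⟨e, he, hS⟩ := exists_ends_of_FL hF hfin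
  have hinj : Function.Injective e := by
    intro u w huw
    by_contra hne
    obtain ⟨p, h1, h2, h3⟩ := hS {u, w}
    refine Set.disjoint_left.1 (h3 u (by simp) w (by simp) hne) (last_mem _) ?_
    rw [h2 u (by simp), huw, ← h2 w (by simp)]
    exact last_mem (p w)
  let r : V → V → Prop := fun b b' => ∃ u : F, e u = b ∧ b' ∈ B ∧ ReflTransGen Adj u b'
  have hcl : ∀ b, {b' | ReflTransGen r b b'}.Countable := countable_reach fun b => by
    by_cases hb : ∃ u, e u = b
    · obtain ⟨u, rfl⟩ := hb
      refine ((hfin u).subset ?_).countable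
      rintro b' ⟨w, hw, h⟩
      rwa [← hinj hw]
    · convert Set.countable_empty
      exact Set.eq_empty_of_forall_notMem fun b' ⟨u, hu, _⟩ => hb ⟨u, hu⟩
  have hwf : WellFounded (WellOrderingRel (α := V)) := IsWellFounded.wf
  let m : V → V := fun b => hwf.min {β | ReflTransGen r β b} ⟨b, .refl⟩
  have hm : ∀ b, ReflTransGen r (m b) b := fun b => hwf.min_mem {β | ReflTransGen r β b} _
  have hm' : ∀ b β, ReflTransGen r β b → ¬ WellOrderingRel β (m b) :=
    fun b β h => hwf.not_lt_min {β | ReflTransGen r β b} h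
  have hpiece : ∀ β : V, {u | ∃ h : u ∈ F, m (e ⟨u, h⟩) = β} ∈ LGB Adj {b | b ∈ B ∧ m b = β} := by
    intro β
    have hsub : {b | b ∈ B ∧ m b = β} ⊆ B := fun b hb => hb.1
    have := union_mem_LGB_of_countable (Adj := Adj) (B := {b | b ∈ B ∧ m b = β}) (I := ∅)
      (X := {u | ∃ h : u ∈ F, m (e ⟨u, h⟩) = β}) ?_ (fun r h => hray r (RDomSet.mono h hsub))
      (empty_mem_LGB) ?_ ?_
    · rwa [Set.empty_union] at this
    · intro v hv h
      by_cases hvB : v ∈ B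
      · exact not_vdomSet_of_sink (hsink v hvB) hv h
      · exact hdom v hvB (VDomSet.mono h hsub)
    · refine Set.MapsTo.countable_of_injOn (t := {b' | ReflTransGen r β b'})
        (f := fun u => if h : u ∈ F then e ⟨u, h⟩ else u) ?_ ?_ (hcl β)
      · rintro u ⟨h, rfl⟩
        simp only [h, dif_pos]
        exact hm _
      · rintro u ⟨h, -⟩ w ⟨h', -⟩ huw
        simp only [h, h', dif_pos] at huw
        exact congrArg Subtype.val (hinj huw)
    · rw [Set.empty_union]
      intro S hSF hSf
      have hSF' : ∀ u ∈ S, u ∈ F := fun u hu => (hSF hu).1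
      obtain ⟨p, h1, h2, h3⟩ := hS (hSf.preimage (f := ((↑) : F → V))
        Subtype.val_injective.injOn).toFinset
      refine mem_LGB_of_rel (fun u x => ∃ h : u ∈ F, x ∈ (p ⟨u, h⟩).verts) (fun u hu => ?_) ?_
      · obtain ⟨h, hβ⟩ := hSF hu
        refine ⟨p ⟨u, h⟩, h1 _, ?_, fun x hx => ⟨h, hx⟩⟩
        rw [h2 _ (by simpa using hu)]
        exact ⟨(he _).1, hβ⟩
      · rintro u hu w hw x ⟨h, hx⟩ ⟨h', hx'⟩
        by_contra hne
        exact Set.disjoint_left.1 (h3 ⟨u, h⟩ (by simpa using hu) ⟨w, h'⟩ (by simpa using hw)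
          fun h => hne (congrArg Subtype.val h)) hx hx'
  have := fun β => mem_LGB_iff.1 (hpiece β)
  choose f hf using this
  refine mem_LGB_of_rel (fun u x => ∃ h : u ∈ F, ReflTransGen (FStep (f (m (e ⟨u, h⟩)))) u x ∧
    ReflTransGen Adj u x ∧ ∃ b ∈ B, m b = m (e ⟨u, h⟩) ∧ ReflTransGen Adj x b) (fun u hu => ?_) ?_
  · obtain ⟨P, h1, h2, h3, -⟩ := (hf (m (e ⟨u, hu⟩))).exists_path (i := u)
      fun w hw => (hf _).src _ _ hw ⟨hu, rfl⟩
    exact ⟨P, h1, h2.1, fun x hx => ⟨hu, h3 x hx, h1 ▸ first_reach P hx, _, h2.1, h2.2,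
      reach_last P hx⟩⟩
  · have aux : ∀ u w : F, ∀ x, ReflTransGen Adj u x →
        (∃ b ∈ B, m b = m (e w) ∧ ReflTransGen Adj x b) →
        ¬ WellOrderingRel (m (e u)) (m (e w)) := by
      rintro u w x hux ⟨b, hb, hbm, hxb⟩
      rw [← hbm]
      exact hm' b _ ((hm (e u)).tail ⟨u, rfl, hb, hux.trans hxb⟩)
    rintro u - w - x ⟨hu, h1, h2, h3⟩ ⟨hw, h1', h2', h3'⟩
    have heq : m (e ⟨u, hu⟩) = m (e ⟨w, hw⟩) := by
      rcases trichotomous_of WellOrderingRel (m (e ⟨u, hu⟩)) (m (e ⟨w, hw⟩)) with h | h | h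
      · exact absurd h (aux _ _ x h2 h3')
      · exact h
      · exact absurd h (aux _ _ x h2' h3)
    rw [heq] at h1
    exact eq_of_reach_of_reach (hf _).inj (fun y hy => (hf _).src _ _ hy ⟨hu, heq⟩)
      (fun y hy => (hf _).src _ _ hy ⟨hw, rfl⟩) h1 h1'

/-- The digraph obtained by deleting the edges that leave `C`. -/
def Halt (Adj : V → V → Prop) (C : Set V) (x y : V) : Prop := Adj x y ∧ x ∉ C

theorem LGB_halt {C I : Set V} (hBC : B ⊆ C) (hI : I ∈ LGB Adj B) : I ∈ LGB (Halt Adj C) C := by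
  classical
  obtain ⟨f, hf⟩ := mem_LGB_iff.1 hI
  have key : ∀ v w, (if v ∈ C then none else f v) = some w → v ∉ C ∧ f v = some w := by
    intro v w h
    split_ifs at h with hv
    exact ⟨hv, h⟩
  refine IsLinking.mem (f := fun v => if v ∈ C then none else f v) ⟨?_, ?_, ?_, ?_, ?_⟩
  · intro v w h
    obtain ⟨h1, h2⟩ := key v w h
    exact (hf.adj v w h2).imp_right fun h => ⟨h, h1⟩
  · intro v h
    by_contra hv
    simp only [hv, if_false] at h
    exact hv (hBC (hf.term v h))
  · intro u v w hu hv
    exact hf.inj u v w (key u w hu).2 (key v w hv).2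
  · intro v w h
    exact hf.src v w (key v w h).2
  · rintro ⟨s, h1, h2⟩
    exact hf.fin ⟨s, h1, fun n => (key _ _ (h2 n)).2⟩

theorem AvoidPath.trans {X : Set V} {v w : V} (h : ReflTransGen (fun a b => Adj a b ∧ b ∉ X) v w)
    (hv : v ∉ X) (hw : AvoidPath Adj B X w) : AvoidPath Adj B X v := by
  obtain ⟨-, b, hb, hr⟩ := hw.reach
  exact avoidPath_of_reach (h.trans hr) hv hb

theorem avoidPath_self {X : Set V} {v : V} (hv : v ∉ X) (hB : v ∈ B) : AvoidPath Adj B X v :=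
  avoidPath_of_reach .refl hv hB

/-- All but finitely many vertices of a dominating ray have a path to `B` avoiding `X`. -/
theorem exists_finite_avoid_of_rdomSet {q : DiRay Adj} (hq : RDomSet Adj B q) {X : Set V}
    (hX : X.Finite) :
    ∃ X' : Set V, X'.Finite ∧ ∀ v ∈ q.vertexSet, v ∉ X' → AvoidPath Adj B X v := by
  obtain ⟨N, hN⟩ := (hX.preimage (f := q.f) q.inj.injOn).bddAbove
  refine ⟨q.f '' Set.Iic N, (Set.finite_Iic N).image _, ?_⟩
  rintro _ ⟨n, rfl⟩ hn
  have hn' : N < n := by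
    by_contra h
    exact hn ⟨n, not_lt.1 h, rfl⟩
  have htail : ∀ k ≥ n, q.f k ∉ X := fun k hk h => by
    have : k ≤ N := hN h
    omega
  obtain ⟨_, ⟨k, rfl⟩, hk⟩ := avoid_of_rdomSet hq (hX.union ((Set.finite_Iio n).image q.f))
  have hnk : n ≤ k := by
    by_contra h
    exact hk.reach.1 (Or.inr ⟨k, not_le.1 h, rfl⟩)
  refine AvoidPath.trans (w := q.f k) ?_ (htail n le_rfl) (hk.mono Set.subset_union_left)
  clear hk
  induction k, hnk using Nat.le_induction with
  | base => exact .refl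
  | succ k hk ih => exact ih.tail ⟨q.adj k, htail (k + 1) (by omega)⟩

/-- If there is no infinite family of disjoint dominating rays, then finitely many dominating rays
meet all dominating rays. -/
theorem exists_finite_meeting (hrays : ¬ ∃ R : ℕ → DiRay Adj,
      (∀ m n, m ≠ n → Disjoint (R m).vertexSet (R n).vertexSet) ∧ ∀ n, RDomSet Adj B (R n)) :
    ∃ s : Finset (DiRay Adj), (∀ q ∈ s, RDomSet Adj B q) ∧
      ∀ r, RDomSet Adj B r → ∃ q ∈ s, ¬ Disjoint q.vertexSet r.vertexSet := by
  by_contra! hc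
  let r : DiRay Adj → DiRay Adj → Prop := fun P Q => Disjoint P.vertexSet Q.vertexSet
  have : Std.Symm r := ⟨fun P Q h => h.symm⟩
  obtain ⟨R, h1, h2⟩ := exists_seq_of_forall_finset_exists' (fun q => RDomSet Adj B q) r hc
  exact hrays ⟨R, fun m n h => h2 h, h1⟩

theorem LGB_last_mem {Adj' : V → V → Prop} (hAdj : ∀ x y, Adj' x y → Adj x y) {F : Set V}
    {P : F → DiPath Adj'} (h1 : ∀ u : F, (P u).first = u)
    (h2 : ∀ u w, u ≠ w → Disjoint (P u).vertexSet (P w).vertexSet) :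
    {u | ∃ h : u ∈ F, (P ⟨u, h⟩).last ∈ B} ∈ LGB Adj B := by
  refine mem_LGB_of_rel (fun u x => ∃ h : u ∈ F, x ∈ (P ⟨u, h⟩).verts) ?_ ?_
  · rintro u ⟨hu, huB⟩
    exact ⟨⟨_, (P ⟨u, hu⟩).ne, (P ⟨u, hu⟩).chain.imp hAdj, (P ⟨u, hu⟩).nodup⟩, h1 ⟨u, hu⟩, huB,
      fun x hx => ⟨hu, hx⟩⟩
  · rintro u - w - x ⟨hu, hx⟩ ⟨hw, hx'⟩
    by_contra hne
    exact Set.disjoint_left.1 (h2 ⟨u, hu⟩ ⟨w, hw⟩ fun h => hne (congrArg Subtype.val h)) hx hx'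

theorem injOn_last {F : Set V} {P : F → DiPath Adj}
    (h2 : ∀ u w, u ≠ w → Disjoint (P u).vertexSet (P w).vertexSet) :
    Function.Injective fun u => (P u).last := by
  intro u w h
  by_contra hne
  have h' : (P u).last = (P w).last := h
  exact Set.disjoint_left.1 (h2 u w hne) (last_mem _) (h' ▸ last_mem _)

theorem nearlyFinitary_of_no_dominating_vertex (hdom : ∀ v, v ∉ B → ¬ VDomSet Adj B v)
    (hrays : ¬ ∃ R : ℕ → DiRay Adj,
      (∀ m n, m ≠ n → Disjoint (R m).vertexSet (R n).vertexSet) ∧ ∀ n, RDomSet Adj B (R n))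
    {F : Set V} (hF : FL Adj B F) : ∃ I ⊆ F, I ∈ LGB Adj B ∧ (F \ I).Finite := by
  obtain ⟨s, hs1, hs2⟩ := exists_finite_meeting hrays
  let C : Set V := ⋃ q ∈ s, q.vertexSet
  have hC : C.Countable := s.countable_toSet.biUnion fun q _ => Set.countable_range _
  have htrans : ∀ X : Set V, X.Finite → ∃ X' : Set V, X'.Finite ∧ X ⊆ X' ∧
      ∀ v ∈ B ∪ C, v ∉ X' → AvoidPath Adj B X v := by
    intro X hX
    have := fun q : s => exists_finite_avoid_of_rdomSet (hs1 q q.2) hX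
    choose Y hY1 hY2 using this
    refine ⟨X ∪ ⋃ q, Y q, hX.union (Set.finite_iUnion hY1), Set.subset_union_left, ?_⟩
    rintro v (hv | hv) hvX
    · exact avoidPath_self (fun h => hvX (Or.inl h)) hv
    · obtain ⟨q, hq, hvq⟩ := Set.mem_iUnion₂.1 hv
      exact hY2 ⟨q, hq⟩ v hvq fun h => hvX (Or.inr (Set.mem_iUnion.2 ⟨_, h⟩))
  have hmem : F ∈ LGB (Halt Adj (B ∪ C)) (B ∪ C) := by
    refine mem_LGB_of_FL (fun b hb y h => h.2 hb) ?_ ?_ ?_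
    · intro v hv h
      refine hdom v (fun h => hv (Or.inl h)) (vdomSet_of_avoid (fun h => hv (Or.inl h)) ?_)
      intro X hX hvX
      obtain ⟨X', h1, h2, h3⟩ := htrans X hX
      obtain ⟨-, w, hw, hr⟩ := (avoid_of_vdomSet h (h1.sdiff (t := {v})) (by simp)).reach
      have hXb : ∀ b, b ∉ X' \ {v} → b ∉ X := fun b hb hbX =>
        hb ⟨h2 hbX, fun hbv : b = v => hvX (hbv ▸ hbX)⟩
      have hwX : w ∉ X' \ {v} := by
        rcases hr.cases_tail with rfl | ⟨_, -, h⟩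
        · simp
        · exact h.2
      refine AvoidPath.trans (ReflTransGen.mono (fun a b h => ⟨h.1.1, hXb b h.2⟩) _ _ hr) hvX
        (h3 w hw fun h => hwX ⟨h, fun hwv : w = v => hv (hwv ▸ hw)⟩)
    · intro r hr
      have hrdom : RDomSet Adj B ⟨r.f, r.inj, fun n => (r.adj n).1⟩ := by
        refine rdomSet_of_avoid fun X hX => ?_
        obtain ⟨X', h1, h2, h3⟩ := htrans X hX
        obtain ⟨v, hv, P, rfl, h5, h6⟩ := avoid_of_rdomSet hr h1
        refine ⟨_, hv, AvoidPath.trans (w := P.last) ?_ (fun h => h6 _ (first_mem P) (h2 h))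
          (h3 _ h5 (h6 _ (last_mem P)))⟩
        exact ReflTransGen.mono (fun a b h => ⟨h.1.1, fun hb => h6 _ h.2.2 (h2 hb)⟩) _ _
          (reach_of_path P (last_mem P)).1
      obtain ⟨q, hq, hqr⟩ := hs2 _ hrdom
      refine hqr (Set.disjoint_left.2 ?_)
      rintro _ hx ⟨n, rfl⟩
      exact (r.adj n).2 (Or.inr (Set.mem_biUnion hq hx))
    · exact fun S hS hSf => LGB_halt Set.subset_union_left (hF S hS hSf)
  obtain ⟨P, h1, h2, h3⟩ := hmem
  let I : Set V := {u | ∃ h : u ∈ F, (P ⟨u, h⟩).last ∈ B}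
  have hmemI : I ∈ LGB Adj B := LGB_last_mem (fun _ _ h => h.1) h1 h3
  have hIF : I ∪ F \ I = F := Set.union_sdiff_cancel fun u hu => hu.1
  have hX : (F \ I).Countable := by
    have hmaps : ∀ u : ↥(F \ I), (P ⟨u, u.2.1⟩).last ∈ C := fun u =>
      (h2 ⟨u, u.2.1⟩).resolve_left fun h => u.2.2 ⟨u.2.1, h⟩
    have := hC.to_subtype
    refine Set.countable_coe_iff.1 (Function.Injective.countable
      (f := fun u : ↥(F \ I) => (⟨_, hmaps u⟩ : C)) fun u w h => ?_)
    have := injOn_last h3 (congrArg Subtype.val h)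
    exact Subtype.ext (congrArg (fun u : F => (u : V)) this)
  obtain ⟨J, hJ1, hJ2, ρ, hρ1, hρ2⟩ := exists_mem_LGB_and_rays hdom
    hmemI hX (hIF.symm ▸ hF)
  refine ⟨J, hIF ▸ hJ1, hJ2, ?_⟩
  by_contra hinf
  have : Infinite ↥((I ∪ F \ I) \ J) := by
    rw [hIF]
    exact Set.infinite_coe_iff.2 hinf
  let g := Infinite.natEmbedding ↥((I ∪ F \ I) \ J)
  exact hrays ⟨fun n => ρ (g n), fun m n hmn => hρ2 _ _ fun h => hmn (g.injective h),
    fun n => hρ1 _⟩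

theorem nearlyFinitary (hrays : ¬ ∃ R : ℕ → DiRay Adj,
      (∀ m n, m ≠ n → Disjoint (R m).vertexSet (R n).vertexSet) ∧ ∀ n, RDomSet Adj B (R n))
    (hverts : {v : V | VDomSet Adj B v}.Finite) {F : Set V} (hF : FL Adj B F) :
    ∃ I ⊆ F, I ∈ LGB Adj B ∧ (F \ I).Finite := by
  let D := {v : V | VDomSet Adj B v}
  have hdom : ∀ v, v ∉ B ∪ D → ¬ VDomSet Adj (B ∪ D) v := by
    intro v hv h
    refine hv (Or.inr (vdomSet_of_avoid (fun h => hv (Or.inl h)) fun X hX hvX => ?_))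
    obtain ⟨P, h1, h2, h3⟩ := avoid_of_vdomSet h (hX.union hverts)
      fun h => h.elim hvX fun h => hv (Or.inr h)
    exact ⟨P, h1, h2.resolve_right fun h => h3 _ (last_mem P) (Or.inr h),
      fun u hu h => h3 u hu (Or.inl h)⟩
  have hrdom : ∀ r : DiRay Adj, RDomSet Adj (B ∪ D) r → RDomSet Adj B r := by
    intro r h
    refine rdomSet_of_avoid fun X hX => ?_
    obtain ⟨v, hv, P, h1, h2, h3⟩ := avoid_of_rdomSet h (hX.union hverts)
    exact ⟨v, hv, P, h1, h2.resolve_right fun h => h3 _ (last_mem P) (Or.inr h),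
      fun u hu h => h3 u hu (Or.inl h)⟩
  obtain ⟨I, hIF, ⟨P, h1, h2, h3⟩, hfin⟩ := nearlyFinitary_of_no_dominating_vertex hdom
    (fun ⟨R, h1, h2⟩ => hrays ⟨R, h1, fun n => hrdom _ (h2 n)⟩) (F := F) (by
      intro S hS hSf
      obtain ⟨P, h1, h2, h3⟩ := hF S hS hSf
      exact ⟨P, h1, fun v => Or.inl (h2 v), h3⟩)
  refine ⟨_, ?_, LGB_last_mem (fun _ _ h => h) h1 h3, ?_⟩
  · rintro u ⟨hu, -⟩
    exact hIF hu
  · have hI : {u : I | (P u).last ∈ D}.Finite :=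
      Set.Finite.of_injOn (t := D) (fun u hu => hu) (injOn_last h3).injOn hverts
    refine (hfin.union (hI.image Subtype.val)).subset fun u hu => ?_
    by_cases huI : u ∈ I
    · exact Or.inr ⟨⟨u, huI⟩, (h2 _).resolve_left fun h => hu.2 ⟨huI, h⟩, rfl⟩
    · exact Or.inl ⟨hu.1, huI⟩

end

end DiLink

theorem stmt18 {V : Type*} (Adj : V → V → Prop) (B : Set V)
    (hrays : ¬ ∃ R : ℕ → DiRay Adj,
      (∀ m n, m ≠ n → Disjoint (R m).vertexSet (R n).vertexSet) ∧
      ∀ n, RDomSet Adj B (R n))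
    (hverts : {v : V | VDomSet Adj B v}.Finite) :
    ∃ M : Matroid V, M.E = Set.univ ∧
      ∀ J : Set V, M.Indep J ↔ J ∈ LGB Adj B :=
  DiLink.exists_matroid_of_nearlyFinitary fun _ hF => DiLink.nearlyFinitary hrays hverts hF
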